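/- Let (R,m) be a Cohen-Macaulay local ring of Krull dimension d and let C be a semidualizing R-module. Then the following conditions are equivalent: (i) R is Gorenstein; (ii) the C-injective dimension of H_m^d(C) is finite; (iii) H_m^d(C) is C-injective. -/

import Mathlib

/-!
Common definitions: semidualizing modules, `C`-injective modules and dimensions,
`G_C`-injective modules, Bass/Auslander classes, relative Cohen-Macaulayness,
Cohen-Macaulay and Gorenstein local rings, trivial extensions, ideal torsion.
-/

noncomputable section

open CategoryTheory TensorProduct

universe u

variable (R : Type u) [CommRing R]

/-- An `R`-module `M` is `C`-injective if it is isomorphic to `Hom_R(C, I)`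
for some injective `R`-module `I`. -/
def IsCInjective (C M : ModuleCat.{u} R) : Prop :=
  ∃ I : ModuleCat.{u} R, Module.Injective R I ∧ Nonempty (M ≃ₗ[R] (C →ₗ[R] I))

/-- `HasCoresDimLE R P n M` : the module `M` admits a coresolution of length at most `n`
by modules satisfying the property `P`. -/
def HasCoresDimLE (P : ModuleCat.{u} R → Prop) : ℕ → ModuleCat.{u} R → Prop
  | 0, M => Subsingleton M ∨ P M
  | n + 1, M => Subsingleton M ∨ ∃ (X : ModuleCat.{u} R) (f : M →ₗ[R] X),
      P X ∧ Function.Injective f ∧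
        HasCoresDimLE P n (ModuleCat.of R (X ⧸ LinearMap.range f))

/-- The coresolution dimension of `M` with respect to the class of modules satisfying `P`,
as an element of `ℕ∞` (`⊤` meaning no finite coresolution exists). -/
def coresDim (P : ModuleCat.{u} R → Prop) (M : ModuleCat.{u} R) : ℕ∞ :=
  sInf {d : ℕ∞ | ∃ n : ℕ, d = n ∧ HasCoresDimLE R P n M}

/-- The `C`-injective dimension of `M`. -/
def cinjDim (C M : ModuleCat.{u} R) : ℕ∞ :=
  coresDim R (IsCInjective R C) M

/-- The injective dimension of `M`. -/
def injDim (M : ModuleCat.{u} R) : ℕ∞ :=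
  coresDim R (fun N => Module.Injective R N) M

/-- A finitely generated `R`-module `C` is semidualizing if the natural map
`R → Hom_R(C,C)` is bijective and `Ext_R^i(C,C) = 0` for all `i ≥ 1`. -/
def IsSemidualizing (C : ModuleCat.{u} R) : Prop :=
  Module.Finite R C ∧ Function.Bijective (LinearMap.lsmul R C) ∧
    ∀ i : ℕ, 1 ≤ i →
      Subsingleton (((Ext R (ModuleCat.{u} R) i).obj (Opposite.op C)).obj C)

/-- A dualizing module is a semidualizing module of finite injective dimension. -/
def IsDualizing (C : ModuleCat.{u} R) : Prop :=
  IsSemidualizing R C ∧ injDim R C ≠ ⊤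

/-- A complete `I_C I`-resolution: an exact complex `Y` (with `d i : Y (i+1) → Y i`)
which stays exact after applying `Hom_R(I, -)` for every `C`-injective `I`, whose terms
in positive degrees are `C`-injective and whose terms in degrees `≤ 0` are injective. -/
structure CompleteICIResolution (C : ModuleCat.{u} R) where
  Y : ℤ → ModuleCat.{u} R
  d : (i : ℤ) → (Y (i + 1) →ₗ[R] Y i)
  exact : ∀ i : ℤ, Function.Exact (d (i + 1)) (d i)
  cinj_pos : ∀ i : ℤ, 0 < i → IsCInjective R C (Y i)
  inj_nonpos : ∀ i : ℤ, i ≤ 0 → Module.Injective R (Y i)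
  homExact : ∀ I : ModuleCat.{u} R, IsCInjective R C I → ∀ i : ℤ,
    Function.Exact (fun f : I →ₗ[R] Y (i + 1 + 1) => (d (i + 1)).comp f)
      (fun f : I →ₗ[R] Y (i + 1) => (d i).comp f)

/-- A module is `G_C`-injective if it is the kernel of the degree-`0` differential of some
complete `I_C I`-resolution. -/
def IsGCInjective (C M : ModuleCat.{u} R) : Prop :=
  ∃ res : CompleteICIResolution R C,
    Nonempty (M ≃ₗ[R] ↥(LinearMap.ker (res.d (-1))))

/-- The `G_C`-injective dimension of `M`. -/
def gcinjDim (C M : ModuleCat.{u} R) : ℕ∞ :=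
  coresDim R (IsGCInjective R C) M

/-- `M` is relative Cohen-Macaulay with respect to `a`: there is exactly one
non-vanishing local cohomology module of `M` with respect to `a`. -/
def IsRelativeCM (a : Ideal R) (M : ModuleCat.{u} R) : Prop :=
  ∃! n : ℕ, Nontrivial ((localCohomology a n).obj M)

/-- `M` is relative Cohen-Macaulay with respect to `a`, with (unique) non-vanishing
local cohomology in degree `n`. -/
def IsRelativeCMAt (a : Ideal R) (n : ℕ) (M : ModuleCat.{u} R) : Prop :=
  Nontrivial ((localCohomology a n).obj M) ∧
    ∀ i : ℕ, i ≠ n → Subsingleton ((localCohomology a i).obj M)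

/-- The cohomological dimension `cd(a, M)`: the largest `i` with `H_a^i(M) ≠ 0`. -/
def lcCohomDim (a : Ideal R) (M : ModuleCat.{u} R) : ℕ :=
  sSup {i : ℕ | Nontrivial ((localCohomology a i).obj M)}

/-- The grade `grade(a, M)`: the least `i` with `H_a^i(M) ≠ 0`. -/
def lcGrade (a : Ideal R) (M : ModuleCat.{u} R) : ℕ :=
  sInf {i : ℕ | Nontrivial ((localCohomology a i).obj M)}

/-- A Noetherian local ring is Cohen-Macaulay iff `H_m^i(R) = 0` for all `i ≠ dim R`
(Grothendieck's characterization, taken here as the definition). -/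
def IsCohenMacaulayLocalRing (S : Type u) [CommRing S] [IsLocalRing S] : Prop :=
  ∀ i : ℕ, (i : WithBot ℕ∞) ≠ ringKrullDim S →
    Subsingleton ((localCohomology (IsLocalRing.maximalIdeal S) i).obj (ModuleCat.of S S))

/-- A local ring is Gorenstein if it has finite injective dimension over itself. -/
def IsGorensteinLocalRing (S : Type u) [CommRing S] : Prop :=
  injDim S (ModuleCat.of S S) ≠ ⊤

/-- The `a`-torsion submodule `Γ_a(M)` of `M`. -/
def idealTorsion (a : Ideal R) (M : Type u) [AddCommGroup M] [Module R M] :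
    Submodule R M :=
  ⨆ n : ℕ, Submodule.torsionBySet R M ((a ^ n : Ideal R) : Set R)

/-- The Krull dimension of a module, `dim_S N = dim (S / ann_S N)`. -/
def moduleKrullDim (S : Type u) [CommRing S] (N : Type u) [AddCommGroup N] [Module S N] :
    WithBot ℕ∞ :=
  ringKrullDim (S ⧸ Module.annihilator S N)

/-- `ht_M(a) = inf { dim_{R_p} M_p  |  p ∈ Supp (M / a M) }`. -/
def heightWRT (a : Ideal R) (M : Type u) [AddCommGroup M] [Module R M] : WithBot ℕ∞ :=
  ⨅ (p : PrimeSpectrum R) (_ : p ∈ Module.support R (M ⧸ (a • (⊤ : Submodule R M)))),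
    moduleKrullDim (Localization.AtPrime p.asIdeal) (LocalizedModule p.asIdeal.primeCompl M)

/-- Membership in the Bass class `B_C(R)`. -/
def MemBassClass (C M : ModuleCat.{u} R) : Prop :=
  (∀ i : ℕ, 1 ≤ i →
      Subsingleton (((Ext R (ModuleCat.{u} R) i).obj (Opposite.op C)).obj M)) ∧
  (∀ i : ℕ, 1 ≤ i →
      Subsingleton (((Tor (ModuleCat.{u} R) i).obj C).obj (ModuleCat.of R (C →ₗ[R] M)))) ∧
  Function.Bijective
    (TensorProduct.lift ((LinearMap.id : (C →ₗ[R] M) →ₗ[R] (C →ₗ[R] M)).flip))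

/-- Membership in the Auslander class `A_C(R)`. -/
def MemAuslanderClass (C M : ModuleCat.{u} R) : Prop :=
  (∀ i : ℕ, 1 ≤ i →
      Subsingleton (((Tor (ModuleCat.{u} R) i).obj C).obj M)) ∧
  (∀ i : ℕ, 1 ≤ i →
      Subsingleton (((Ext R (ModuleCat.{u} R) i).obj (Opposite.op C)).obj
        (ModuleCat.of R (↥C ⊗[R] ↥M)))) ∧
  Function.Bijective ((TensorProduct.mk R ↥C ↥M).flip)

/-- `HasResDimLE R P n M` : `M` admits a resolution of length at most `n`
by modules satisfying `P`. -/
def HasResDimLE (P : ModuleCat.{u} R → Prop) : ℕ → ModuleCat.{u} R → Prop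
  | 0, M => Subsingleton M ∨ P M
  | n + 1, M => Subsingleton M ∨ ∃ (X : ModuleCat.{u} R) (f : X →ₗ[R] M),
      P X ∧ Function.Surjective f ∧
        HasResDimLE P n (ModuleCat.of R ↥(LinearMap.ker f))

/-- The projective dimension of `M`. -/
def projDim (M : ModuleCat.{u} R) : ℕ∞ :=
  sInf {d : ℕ∞ | ∃ n : ℕ, d = n ∧ HasResDimLE R (fun N => Module.Projective R N) n M}

/-- The first projection of the trivial extension `R ⋉ C`, as a ring homomorphism. -/
def trivExtFst (C : Type u) [AddCommGroup C] [Module R C] [Module Rᵐᵒᵖ C]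
    [IsCentralScalar R C] : TrivSqZeroExt R C →+* R where
  toFun := TrivSqZeroExt.fst
  map_one' := TrivSqZeroExt.fst_one (R := R) (M := C)
  map_mul' := TrivSqZeroExt.fst_mul
  map_zero' := TrivSqZeroExt.fst_zero (R := R) (M := C)
  map_add' := TrivSqZeroExt.fst_add

/-- The ideal `a ⊕ C` of the trivial extension `R ⋉ C`. -/
def trivExtIdeal (a : Ideal R) (C : Type u) [AddCommGroup C] [Module R C] [Module Rᵐᵒᵖ C]
    [IsCentralScalar R C] : Ideal (TrivSqZeroExt R C) :=
  Ideal.comap (trivExtFst R C) a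

/-- An `R`-module `M`, viewed as a module over the trivial extension `R ⋉ C` via the
natural surjection `R ⋉ C → R`. -/
def trivExtModuleCat (C : Type u) [AddCommGroup C] [Module R C] [Module Rᵐᵒᵖ C]
    [IsCentralScalar R C] (M : Type u) [AddCommGroup M] [Module R M] :
    ModuleCat.{u} (TrivSqZeroExt R C) :=
  letI := Module.compHom M (trivExtFst R C)
  ModuleCat.of (TrivSqZeroExt R C) M

end

section
universe u
open CategoryTheory TensorProduct

variable {R : Type u} [CommRing R]

/-- Precomposition with a chain map, as a map of Hom complexes. -/
noncomputable def ChainComplex.linearYonedaMap {P Q : ChainComplex (ModuleCat.{u} R) ℕ} (φ : P ⟶ Q)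
    (Y : ModuleCat.{u} R) : Q.linearYonedaObj R Y ⟶ P.linearYonedaObj R Y where
  f i := ModuleCat.ofHom (Linear.leftComp R Y (φ.f i))
  comm' i j _ := ModuleCat.hom_ext (LinearMap.ext fun f => (φ.comm_assoc j i f).symm)

lemma comp_comp_eq_of_squares {𝒞 : Type*} [Category 𝒞] {A A' B B' D D' : 𝒞} {a : A' ⟶ A} {i : A ⟶ B}
    {i' : A' ⟶ B'} {b : B' ⟶ B} {j : B ⟶ D} {j' : B' ⟶ D'} {c : D' ⟶ D}
    (h : a ≫ i = i' ≫ b) (h' : b ≫ j = j' ≫ c) : a ≫ i ≫ j = (i' ≫ j') ≫ c := by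
  rw [reassoc_of% h, h', Category.assoc]

lemma iso_inv_comp_eq_of_square {𝒞 : Type*} [Category 𝒞] {A A' B B' : 𝒞} {a : A ⟶ A'} {c : B ⟶ B'}
    (e : A ≅ B) (e' : A' ≅ B') (h : a ≫ e'.hom = e.hom ≫ c) : e.inv ≫ a = c ≫ e'.inv := by
  rw [Iso.inv_comp_eq, ← Category.assoc, ← h, Category.assoc, Iso.hom_inv_id, Category.comp_id]

lemma isoExt_naturality {X X' : ModuleCat.{u} R} (g : X ⟶ X')
    (P : ProjectiveResolution X) (P' : ProjectiveResolution X')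
    (φ : P.Hom P' g) (n : ℕ) (Y : ModuleCat.{u} R) :
    ((Ext R (ModuleCat.{u} R) n).map g.op).app Y ≫ (P.isoExt n Y).hom =
      (P'.isoExt n Y).hom ≫
        HomologicalComplex.homologyMap (ChainComplex.linearYonedaMap φ.hom Y) n := by
  have h := ProjectiveResolution.isoLeftDerivedObj_inv_naturality g P P' φ.hom
    (by simpa using φ.hom_f_zero_comp_π_f_zero) ((linearYoneda R (ModuleCat.{u} R)).obj Y).rightOp n
  have h3 := HomologicalComplex.homologyOp_hom_naturality (i := n)
    (ChainComplex.linearYonedaMap φ.hom Y)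
  have h4 := congrArg Quiver.Hom.unop (iso_inv_comp_eq_of_square _ _ h3)
  exact comp_comp_eq_of_squares (congrArg Quiver.Hom.unop h) h4

/-- The cocycles of degree `n` in the complex computing `Ext`. -/
noncomputable def extCocycles {X : ModuleCat.{u} R} (P : ProjectiveResolution X) (n : ℕ)
    (Y : ModuleCat.{u} R) :
    Submodule R (P.complex.X n ⟶ Y) :=
  LinearMap.ker (Linear.leftComp R Y (P.complex.d (n + 1) n))

lemma mem_extCocycles {X : ModuleCat.{u} R} {P : ProjectiveResolution X} {n : ℕ}
    {Y : ModuleCat.{u} R}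
    {f : P.complex.X n ⟶ Y} : f ∈ extCocycles P n Y ↔ P.complex.d (n + 1) n ≫ f = 0 := Iff.rfl

open CategoryTheory.Abelian in
lemma smul_extMk {X : ModuleCat.{u} R} (P : ProjectiveResolution X) {n : ℕ} {Y : ModuleCat.{u} R}
    (r : R) (f : P.complex.X n ⟶ Y) (m : ℕ) (hm : n + 1 = m) (hf : P.complex.d m n ≫ f = 0) :
    P.extMk (r • f) m hm (by simp [hf]) = r • P.extMk f m hm hf := by
  rw [Ext.smul_eq_comp_mk₀, ProjectiveResolution.extMk_comp_mk₀]
  congr 1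
/-- The class of a cocycle. -/
noncomputable def extClass {X : ModuleCat.{u} R} (P : ProjectiveResolution X) (n : ℕ)
    (Y : ModuleCat.{u} R) :
    extCocycles P n Y →ₗ[R] Abelian.Ext X Y n where
  toFun f := P.extMk f.1 (n + 1) rfl f.2
  map_add' f g := (P.add_extMk f.1 g.1 _ rfl f.2 g.2).symm
  map_smul' r f := smul_extMk P r f.1 _ rfl f.2

lemma extClass_surjective {X : ModuleCat.{u} R} (P : ProjectiveResolution X) (n : ℕ)
    (Y : ModuleCat.{u} R) :
    Function.Surjective (extClass P n Y) := by
  intro e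
  obtain ⟨f, hf, h⟩ := P.extMk_surjective e (n + 1) rfl
  exact ⟨⟨f, hf⟩, h⟩

/-- The class of a cocycle in the homology of a cochain complex of modules. -/
noncomputable def homologyClass (K : CochainComplex (ModuleCat.{u} R) ℕ) (n : ℕ) :
    LinearMap.ker (K.d n (n + 1)).hom →ₗ[R] K.homology n :=
  (K.liftCycles (ModuleCat.ofHom (LinearMap.ker (K.d n (n + 1)).hom).subtype) (n + 1) (by simp)
    (by ext x; exact x.2) ≫ K.homologyπ n).hom

lemma homologyClass_surjective (K : CochainComplex (ModuleCat.{u} R) ℕ) (n : ℕ) :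
    Function.Surjective (homologyClass K n) := by
  intro h
  obtain ⟨z, rfl⟩ := (ModuleCat.epi_iff_surjective (K.homologyπ n)).1 inferInstance h
  have hz : (K.d n (n + 1)).hom ((K.iCycles n).hom z) = 0 := by
    have := congrArg (fun f => f.hom z) (K.iCycles_d n (n + 1))
    exact this
  refine ⟨⟨(K.iCycles n).hom z, hz⟩, ?_⟩
  simp only [homologyClass, ModuleCat.hom_comp, LinearMap.comp_apply]
  congr 1
  apply (ModuleCat.mono_iff_injective (K.iCycles n)).1 inferInstance
  have := congrArg (fun f => f.hom (⟨(K.iCycles n).hom z, hz⟩ : LinearMap.ker (K.d n (n + 1)).hom))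
    (K.liftCycles_i (ModuleCat.ofHom (LinearMap.ker (K.d n (n + 1)).hom).subtype) (n + 1) (by simp)
    (by ext x; exact x.2))
  exact this

lemma homologyClass_eq_zero_iff (K : CochainComplex (ModuleCat.{u} R) ℕ) (n p : ℕ)
    (hp : (ComplexShape.up ℕ).prev n = p) (z : LinearMap.ker (K.d n (n + 1)).hom) :
    homologyClass K n z = 0 ↔ ∃ g, (K.d p n).hom g = z.1 := by
  have hex : (ShortComplex.mk (K.toCycles p n) (K.homologyπ n) (by simp)).Exact :=
    ShortComplex.exact_of_g_is_cokernel _ (K.homologyIsCokernel p n hp)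
  rw [ShortComplex.moduleCat_exact_iff] at hex
  have hi : Function.Injective (K.iCycles n).hom :=
    (ModuleCat.mono_iff_injective (K.iCycles n)).1 inferInstance
  have hl : ∀ z, (K.iCycles n).hom
      ((K.liftCycles
    (ModuleCat.ofHom (LinearMap.ker (K.d n (n + 1)).hom).subtype) (n + 1) (by simp)
    (by ext x; exact x.2)).hom z) = z.1 := fun z => congrArg (fun f => f.hom z)
    (K.liftCycles_i (ModuleCat.ofHom (LinearMap.ker (K.d n (n + 1)).hom).subtype) (n + 1) (by simp)
    (by ext x; exact x.2))
  have ht : ∀ g, (K.iCycles n).hom ((K.toCycles p n).hom g) = (K.d p n).hom g := fun g =>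
    congrArg (fun f => f.hom g) (K.toCycles_i p n)
  simp only [homologyClass, ModuleCat.hom_comp, LinearMap.comp_apply]
  constructor
  · intro h
    obtain ⟨g, hg⟩ := hex _ h
    exact ⟨g, by rw [← ht, ← hl]; exact congrArg _ hg⟩
  · rintro ⟨g, hg⟩
    have : (K.liftCycles
        (ModuleCat.ofHom (LinearMap.ker (K.d n (n + 1)).hom).subtype) (n + 1) (by simp)
      (by ext x; exact x.2)).hom z = (K.toCycles p n).hom g := hi (by rw [hl, ht, hg])
    erw [this]
    exact congrArg (fun f => f.hom g) (K.toCycles_comp_homologyπ p n)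

lemma homologyClass_naturality {K L : CochainComplex (ModuleCat.{u} R) ℕ} (φ : K ⟶ L) (n : ℕ)
    (z : LinearMap.ker (K.d n (n + 1)).hom) (w : LinearMap.ker (L.d n (n + 1)).hom)
    (h : (φ.f n).hom z.1 = w.1) :
    (HomologicalComplex.homologyMap φ n).hom (homologyClass K n z) = homologyClass L n w := by
  have hi : Function.Injective (L.iCycles n).hom :=
    (ModuleCat.mono_iff_injective (L.iCycles n)).1 inferInstance
  have hl : ∀ (K : CochainComplex (ModuleCat.{u} R) ℕ) z, (K.iCycles n).hom
      ((K.liftCycles (ModuleCat.ofHom (LinearMap.ker (K.d n (n + 1)).hom).subtype) (n + 1) (by simp)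
    (by ext x; exact x.2)).hom z) = z.1 := fun K z => congrArg (fun f => f.hom z)
    (K.liftCycles_i (ModuleCat.ofHom (LinearMap.ker (K.d n (n + 1)).hom).subtype) (n + 1) (by simp)
    (by ext x; exact x.2))
  simp only [homologyClass, ModuleCat.hom_comp, LinearMap.comp_apply]
  refine (congrArg (fun f : K.cycles n ⟶ L.homology n => f.hom _)
    (HomologicalComplex.homologyπ_naturality φ n)).trans ?_
  simp only [ModuleCat.hom_comp, LinearMap.comp_apply]
  congr 1
  apply hi
  refine (congrArg (fun f : K.cycles n ⟶ L.X n => f.hom _)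
    (HomologicalComplex.cyclesMap_i φ n)).trans ?_
  simp only [ModuleCat.hom_comp, LinearMap.comp_apply]
  rw [hl]
  erw [hl]
  exact h

open CategoryTheory.Abelian in
lemma extMk_degree_zero_eq_zero_iff {X Y : ModuleCat.{u} R} (P : ProjectiveResolution X)
    (f : P.complex.X 0 ⟶ Y) (m : ℕ) (hm : 0 + 1 = m) (hf : P.complex.d m 0 ≫ f = 0) :
    P.extMk f m hm hf = 0 ↔ f = 0 := by
  constructor
  · intro h
    rw [← P.extEquivCohomologyClass.apply_eq_iff_eq,
    ProjectiveResolution.extEquivCohomologyClass_extMk,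
    ProjectiveResolution.extEquivCohomologyClass_zero,
    CochainComplex.HomComplex.CohomologyClass.mk_eq_zero_iff,
    CochainComplex.HomComplex.Cocycle.toSingleMk_mem_coboundaries_iff _ _ _ _ _ 1 (by lia)] at h
    obtain ⟨g, hg⟩ := h
    have hz : P.cochainComplex.d (-(0 : ℕ)) 1 = 0 := by
      apply Limits.IsZero.eq_of_tgt
      exact HomologicalComplex.isZero_extend_X _ _ _ (by rintro i; simp; omega)
    rw [hz, Limits.zero_comp] at hg
    rw [← cancel_epi (P.cochainComplexXIso (-(0:ℕ)) 0 rfl).hom, Limits.comp_zero, ← hg]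
  · rintro rfl
    simp

/-- The class of a cocycle in the homology of the Hom complex. -/
noncomputable def extHomologyClass {X : ModuleCat.{u} R} (P : ProjectiveResolution X) (n : ℕ)
    (Y : ModuleCat.{u} R) : extCocycles P n Y →ₗ[R] (P.complex.linearYonedaObj R Y).homology n :=
  homologyClass (P.complex.linearYonedaObj R Y) n

lemma extHomologyClass_surjective {X : ModuleCat.{u} R} (P : ProjectiveResolution X) (n : ℕ)
    (Y : ModuleCat.{u} R) : Function.Surjective (extHomologyClass P n Y) :=
  homologyClass_surjective _ _

lemma ker_extClass {X : ModuleCat.{u} R} (P : ProjectiveResolution X) (n : ℕ)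
    (Y : ModuleCat.{u} R) :
    LinearMap.ker (extClass P n Y) = LinearMap.ker (extHomologyClass P n Y) := by
  ext f
  rw [LinearMap.mem_ker, LinearMap.mem_ker]
  cases n with
  | zero =>
    refine (extMk_degree_zero_eq_zero_iff P f.1 _ rfl f.2).trans
      (Iff.trans ?_
        (homologyClass_eq_zero_iff (P.complex.linearYonedaObj R Y) 0 0 (by simp) f).symm)
    constructor
    · intro h
      exact ⟨0, by rw [map_zero, h]; rfl⟩
    · rintro ⟨g, hg⟩
      rw [HomologicalComplex.shape _ _ _ (by simp)] at hg
      exact hg.symm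
  | succ p =>
    exact (P.extMk_eq_zero_iff f.1 _ rfl f.2 p rfl).trans
      (homologyClass_eq_zero_iff (P.complex.linearYonedaObj R Y) (p + 1) p (by simp) f).symm

/-- Comparison of the two definitions of `Ext`. -/
noncomputable def oldExtEquiv (X : ModuleCat.{u} R) (n : ℕ) (Y : ModuleCat.{u} R) :
    ((Ext R (ModuleCat.{u} R) n).obj (Opposite.op X)).obj Y ≃ₗ[R] Abelian.Ext X Y n :=
  ((projectiveResolution X).isoExt n Y).toLinearEquiv ≪≫ₗ
  (LinearMap.quotKerEquivOfSurjective _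
    (extHomologyClass_surjective (projectiveResolution X) n Y)).symm ≪≫ₗ
  Submodule.quotEquivOfEq _ _ (ker_extClass _ _ _).symm ≪≫ₗ
  (LinearMap.quotKerEquivOfSurjective _ (extClass_surjective _ _ _))

lemma oldExtEquiv_apply (X : ModuleCat.{u} R) (n : ℕ) (Y : ModuleCat.{u} R)
    (z : ((Ext R (ModuleCat.{u} R) n).obj (Opposite.op X)).obj Y)
    (f : extCocycles (projectiveResolution X) n Y)
    (h : ((projectiveResolution X).isoExt n Y).hom.hom z =
      extHomologyClass (projectiveResolution X) n Y f) :
    oldExtEquiv X n Y z = extClass (projectiveResolution X) n Y f := by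
  have : (LinearMap.quotKerEquivOfSurjective _
      (extHomologyClass_surjective (projectiveResolution X) n Y)).symm
      (((projectiveResolution X).isoExt n Y).hom.hom z) = Submodule.Quotient.mk f := by
    rw [LinearEquiv.symm_apply_eq, h]
    rfl
  refine (congrArg (fun q => (LinearMap.quotKerEquivOfSurjective _ (extClass_surjective _ _ _))
    (Submodule.quotEquivOfEq _ _ (ker_extClass (projectiveResolution X) n Y).symm q)) this).trans ?_
  rfl

lemma oldExtEquiv_naturality {X X' : ModuleCat.{u} R} (g : X ⟶ X') (n : ℕ) (Y : ModuleCat.{u} R)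
    (z : ((Ext R (ModuleCat.{u} R) n).obj (Opposite.op X')).obj Y) :
    oldExtEquiv X n Y ((((Ext R (ModuleCat.{u} R) n).map g.op).app Y).hom z) =
      (Abelian.Ext.mk₀ g).comp (oldExtEquiv X' n Y z) (zero_add n) := by
  let P := projectiveResolution X
  let P' := projectiveResolution X'
  let φ : P.Hom P' g := ⟨ProjectiveResolution.lift g P P', by
    have := congrArg (fun f => HomologicalComplex.Hom.f f 0)
      (ProjectiveResolution.lift_commutes g P P')
    exact this⟩
  obtain ⟨f, hf⟩ := extHomologyClass_surjective P' n Y ((P'.isoExt n Y).hom.hom z)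
  have hf' : (φ.hom.f n ≫ f.1 : P.complex.X n ⟶ Y) ∈ extCocycles P n Y := by
    have : P'.complex.d (n+1) n ≫ f.1 = 0 := f.2
    rw [mem_extCocycles, ← φ.hom.comm_assoc, this, Limits.comp_zero]
  rw [oldExtEquiv_apply X' n Y z f hf.symm, oldExtEquiv_apply X n Y _ ⟨_, hf'⟩]
  · exact (ProjectiveResolution.mk₀_comp_extMk f.1 _ rfl f.2 φ).symm
  · have := congrArg (fun f => f.hom z) (isoExt_naturality g P P' φ n Y)
    refine this.trans ?_
    refine (congrArg (HomologicalComplex.homologyMap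
      (ChainComplex.linearYonedaMap φ.hom Y) n).hom hf.symm).trans ?_
    exact homologyClass_naturality _ _ _ _ rfl

end

section
universe u
open CategoryTheory TensorProduct Limits Opposite

variable {R : Type u} [CommRing R]

/-- The projection `R ⧸ I → R ⧸ J` for `I ≤ J`. -/
noncomputable def quotProj {I J : Ideal R} (h : I ≤ J) :
    ModuleCat.of R (R ⧸ I) ⟶ ModuleCat.of R (R ⧸ J) :=
  ModuleCat.ofHom (Submodule.mapQ _ _ LinearMap.id h)

/-- `H` is the colimit of the modules `Ext^i(R/I^n, M)`. -/
structure IsExtColimit (I : Ideal R) (i : ℕ) (M H : ModuleCat.{u} R)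
    (ι : ∀ n : ℕ, Abelian.Ext (ModuleCat.of R (R ⧸ I ^ n)) M i →ₗ[R] H) : Prop where
  compat : ∀ n N (h : n ≤ N) (e : Abelian.Ext (ModuleCat.of R (R ⧸ I ^ n)) M i),
    ι N ((Abelian.Ext.mk₀ (quotProj (Ideal.pow_le_pow_right h))).comp e (zero_add i)) = ι n e
  surj : ∀ h : H, ∃ n e, ι n e = h
  zero : ∀ n e, ι n e = 0 → ∃ N, ∃ h : n ≤ N,
    (Abelian.Ext.mk₀ (quotProj (Ideal.pow_le_pow_right h))).comp e (zero_add i) = 0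

lemma exists_isExtColimit_localCohomology (I : Ideal R) (i : ℕ) (M : ModuleCat.{u} R) :
    ∃ ι, IsExtColimit I i M ((localCohomology I i).obj M) ι := by
  let D := localCohomology.diagram (localCohomology.idealPowersDiagram I) i
  let F : ℕᵒᵖᵒᵖ ⥤ ModuleCat.{u} R := D ⋙ (evaluation _ _).obj M
  have : PreservesFilteredColimitsOfSize.{0, 0} (forget (ModuleCat.{u} R)) :=
    preservesFilteredColimitsOfSize_shrink.{0, u, 0, u} _
  have : PreservesColimit F (forget (ModuleCat.{u} R)) :=
    (PreservesFilteredColimitsOfSize.preserves_filtered_colimits (F := forget (ModuleCat.{u} R))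
      ℕᵒᵖᵒᵖ).preservesColimit
  have : HasColimit D := inferInstance
  let c : Cocone D := colimit.cocone D
  let c' := ((evaluation _ _).obj M).mapCocone c
  have hc : IsColimit c' := isColimitOfPreserves _ (colimit.isColimit D)
  have hpt : c'.pt = (localCohomology I i).obj M := rfl
  let ι : ∀ n : ℕ, Abelian.Ext (ModuleCat.of R (R ⧸ I ^ n)) M i →ₗ[R] c'.pt := fun n =>
    (c'.ι.app (op (op n))).hom ∘ₗ (oldExtEquiv (ModuleCat.of R (R ⧸ I ^ n)) i M).symm.toLinearMap
  have key : ∀ n N (h : n ≤ N) (e : Abelian.Ext (ModuleCat.of R (R ⧸ I ^ n)) M i),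
      (oldExtEquiv (ModuleCat.of R (R ⧸ I ^ N)) i M).symm
        ((Abelian.Ext.mk₀ (quotProj (Ideal.pow_le_pow_right h))).comp e (zero_add i)) =
      (F.map (homOfLE h).op.op).hom ((oldExtEquiv (ModuleCat.of R (R ⧸ I ^ n)) i M).symm e) := by
    intro n N h e
    refine (LinearEquiv.symm_apply_eq _).2
      (Eq.trans ?_ (oldExtEquiv_naturality (quotProj (Ideal.pow_le_pow_right h)) i M _).symm)
    rw [LinearEquiv.apply_symm_apply]
  refine ⟨ι, ?_, ?_, ?_⟩
  · intro n N h e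
    change (c'.ι.app (op (op N))).hom _ = (c'.ι.app (op (op n))).hom _
    erw [key]
    exact congrArg (fun f : F.obj (op (op n)) ⟶ c'.pt => f.hom _) (c'.w (homOfLE h).op.op)
  · intro h
    obtain ⟨j, y, hy⟩ := Concrete.isColimit_exists_rep F hc h
    obtain ⟨⟨n⟩⟩ := j
    refine ⟨n, oldExtEquiv _ i M y, ?_⟩
    change (c'.ι.app (op (op n))).hom ((oldExtEquiv (ModuleCat.of R (R ⧸ I ^ n)) i M).symm _) = h
    erw [LinearEquiv.symm_apply_apply]
    exact hy
  · intro n e h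
    have h' : c'.ι.app (op (op n)) ((oldExtEquiv (ModuleCat.of R (R ⧸ I ^ n)) i M).symm e) =
      c'.ι.app (op (op n)) (0 : F.obj (op (op n))) := by
      rw [map_zero]; exact h
    obtain ⟨k, f, g, hk⟩ := (Concrete.isColimit_rep_eq_iff_exists F hc _ _).1 h'
    obtain ⟨⟨N⟩⟩ := k
    have hle : n ≤ N := leOfHom f.unop.unop
    refine ⟨N, hle, ?_⟩
    apply (oldExtEquiv (ModuleCat.of R (R ⧸ I ^ N)) i M).symm.injective
    rw [key, map_zero]
    rw [map_zero] at hk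
    exact hk

end

section
universe u
open CategoryTheory TensorProduct

section
variable (R : Type u) [CommRing R]

/-- The module `Ext^i_R(N, M)` for unbundled modules. -/
abbrev ExtMod (N M : Type u) [AddCommGroup N] [Module R N] [AddCommGroup M] [Module R M] (i : ℕ) :
    Type u :=
  Abelian.Ext (ModuleCat.of R N) (ModuleCat.of R M) i
end

namespace ExtMod
variable {R : Type u} [CommRing R]
variable {N N' N'' M M' M'' : Type u} [AddCommGroup N] [Module R N] [AddCommGroup N'] [Module R N']
  [AddCommGroup N''] [Module R N''] [AddCommGroup M] [Module R M] [AddCommGroup M'] [Module R M']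
  [AddCommGroup M''] [Module R M'']

variable (M) in
/-- Contravariant functoriality of `Ext`. -/
noncomputable def pre (i : ℕ) (f : N →ₗ[R] N') : ExtMod R N' M i →ₗ[R] ExtMod R N M i where
  toFun e := (Abelian.Ext.mk₀ (ModuleCat.ofHom f)).comp e (zero_add i)
  map_add' := by simp
  map_smul' := by simp

variable (N) in
/-- Covariant functoriality of `Ext`. -/
noncomputable def post (i : ℕ) (g : M →ₗ[R] M') : ExtMod R N M i →ₗ[R] ExtMod R N M' i where
  toFun e := e.comp (Abelian.Ext.mk₀ (ModuleCat.ofHom g)) (add_zero i)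
  map_add' := by simp
  map_smul' := by simp

@[simp] lemma pre_id (i : ℕ) (e : ExtMod R N M i) : pre M i LinearMap.id e = e :=
  Abelian.Ext.mk₀_id_comp e

lemma pre_pre (i : ℕ) (f : N →ₗ[R] N') (g : N' →ₗ[R] N'') (e : ExtMod R N'' M i) :
    pre M i f (pre M i g e) = pre M i (g ∘ₗ f) e := by
  simp only [pre, LinearMap.coe_mk, AddHom.coe_mk, ModuleCat.ofHom_comp]
  rw [← Abelian.Ext.mk₀_comp_mk₀_assoc]

lemma post_post (i : ℕ) (f : M →ₗ[R] M') (g : M' →ₗ[R] M'') (e : ExtMod R N M i) :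
    post N i g (post N i f e) = post N i (g ∘ₗ f) e := by
  simp only [post, LinearMap.coe_mk, AddHom.coe_mk, ModuleCat.ofHom_comp]
  rw [← Abelian.Ext.mk₀_comp_mk₀, Abelian.Ext.comp_assoc]
  omega

lemma pre_post (i : ℕ) (f : N →ₗ[R] N') (g : M →ₗ[R] M') (e : ExtMod R N' M i) :
    pre M' i f (post N' i g e) = post N i g (pre M i f e) := by
  simp only [post, pre, LinearMap.coe_mk, AddHom.coe_mk]
  rw [Abelian.Ext.comp_assoc]
  omega

lemma post_smul_id (i : ℕ) (r : R) (e : ExtMod R N M i) :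
    post N i (r • LinearMap.id) e = r • e := by
  rw [Abelian.Ext.smul_eq_comp_mk₀]
  rfl

lemma pre_add (i : ℕ) (f g : N →ₗ[R] N') (e : ExtMod R N' M i) :
    pre M i (f + g) e = pre M i f e + pre M i g e := by
  simp [pre, ModuleCat.ofHom_add, Abelian.Ext.mk₀_add]

lemma post_add (i : ℕ) (f g : M →ₗ[R] M') (e : ExtMod R N M i) :
    post N i (f + g) e = post N i f e + post N i g e := by
  simp [post, ModuleCat.ofHom_add, Abelian.Ext.mk₀_add]

lemma pre_zero (i : ℕ) (e : ExtMod R N' M i) : pre M i (0 : N →ₗ[R] N') e = 0 := by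
  simpa using pre_add i (0 : N →ₗ[R] N') 0 e

lemma post_zero (i : ℕ) (e : ExtMod R N M i) : post N i (0 : M →ₗ[R] M') e = 0 := by
  simpa using post_add i (0 : M →ₗ[R] M') 0 e

lemma pre_smul (i : ℕ) (r : R) (f : N →ₗ[R] N') (e : ExtMod R N' M i) :
    pre M i (r • f) e = r • pre M i f e := by
  change (Abelian.Ext.mk₀ (r • ModuleCat.ofHom f)).comp e (zero_add i) = _
  rw [Abelian.Ext.mk₀_smul, Abelian.Ext.smul_comp]
  rfl

lemma subsingleton_of_projective [Module.Projective R N] (i : ℕ) :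
    Subsingleton (ExtMod R N M (i + 1)) := by
  have : Projective (ModuleCat.of R N) := (IsProjective.iff_projective N).1 inferInstance
  exact ⟨fun a b => (Abelian.Ext.eq_zero_of_projective a).trans
    (Abelian.Ext.eq_zero_of_projective b).symm⟩

lemma subsingleton_of_injective (h : Module.Injective R M) (i : ℕ) :
    Subsingleton (ExtMod R N M (i + 1)) := by
  have : Injective (ModuleCat.of R M) := Module.injective_object_of_injective_module R M
  exact ⟨fun a b => (Abelian.Ext.eq_zero_of_injective a).trans
    (Abelian.Ext.eq_zero_of_injective b).symm⟩

lemma finite [IsNoetherianRing R] [Module.Finite R N] [Module.Finite R M] (i : ℕ) :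
    Module.Finite R (ExtMod R N M i) :=
  ModuleCat.finite_ext R _ _ i

lemma subsingleton_of_left [Subsingleton N] (i : ℕ) : Subsingleton (ExtMod R N M i) :=
  ⟨fun a b => by rw [← pre_id i a, ← pre_id i b,
    show (LinearMap.id : N →ₗ[R] N) = 0 from Subsingleton.elim _ _, pre_zero, pre_zero]⟩

/-- `Ext^0` is `Hom`. -/
noncomputable def homEquiv : (N →ₗ[R] M) ≃ₗ[R] ExtMod R N M 0 :=
  (ModuleCat.homLinearEquiv (S := R) (M := ModuleCat.of R N) (N := ModuleCat.of R M)).symm ≪≫ₗ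
    Abelian.Ext.linearEquiv₀.symm

lemma homEquiv_apply (f : N →ₗ[R] M) : homEquiv f = Abelian.Ext.mk₀ (ModuleCat.ofHom f) := rfl

lemma pre_homEquiv (f : N →ₗ[R] N') (g : N' →ₗ[R] M) :
    pre M 0 f (homEquiv g) = homEquiv (g ∘ₗ f) := by
  simp [pre, homEquiv_apply, ModuleCat.ofHom_comp]

lemma post_homEquiv (f : N →ₗ[R] M) (g : M →ₗ[R] M') :
    post N 0 g (homEquiv f) = homEquiv (g ∘ₗ f) := by
  simp [post, homEquiv_apply, ModuleCat.ofHom_comp]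

section LES
variable {f : M →ₗ[R] M'} {g : M' →ₗ[R] M''}

/-- The short complex of a short exact sequence of modules. -/
abbrev sc (hex : Function.Exact f g) : ShortComplex (ModuleCat.{u} R) :=
  ShortComplex.mk (ModuleCat.ofHom f) (ModuleCat.ofHom g)
    (ModuleCat.hom_ext (LinearMap.ext fun x => hex.apply_apply_eq_zero x))

lemma sc_shortExact (hf : Function.Injective f) (hex : Function.Exact f g)
    (hg : Function.Surjective g) : (sc hex).ShortExact :=
  ModuleCat.shortComplex_shortExact _ hex hf hg

variable (hf : Function.Injective f) (hex : Function.Exact f g) (hg : Function.Surjective g)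

variable (N) in
/-- The covariant connecting map. -/
noncomputable def cov (i : ℕ) : ExtMod R N M'' i →ₗ[R] ExtMod R N M (i + 1) where
  toFun e := e.comp (sc_shortExact hf hex hg).extClass rfl
  map_add' := by simp
  map_smul' := by simp

include hf hex hg in
lemma post_exact (i : ℕ) : Function.Exact (post N i f) (post N i g) := by
  intro e
  constructor
  · intro h
    obtain ⟨x, hx⟩ := Abelian.Ext.covariant_sequence_exact₂ _ (sc_shortExact hf hex hg) e h
    exact ⟨x, hx⟩
  · rintro ⟨x, rfl⟩
    rw [post_post, show g ∘ₗ f = 0 from LinearMap.ext hex.apply_apply_eq_zero, post_zero]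

lemma post_cov_exact (i : ℕ) : Function.Exact (post N i g) (cov N hf hex hg i) := by
  intro e
  constructor
  · intro h
    obtain ⟨x, hx⟩ := Abelian.Ext.covariant_sequence_exact₃ _ (sc_shortExact hf hex hg) e rfl h
    exact ⟨x, hx⟩
  · rintro ⟨x, rfl⟩
    simp only [cov, post, LinearMap.coe_mk, AddHom.coe_mk]
    rw [Abelian.Ext.comp_assoc _ _ _ (add_zero i) (zero_add 1) (by omega)]
    erw [(sc_shortExact hf hex hg).comp_extClass]
    simp

lemma cov_post_exact (i : ℕ) : Function.Exact (cov N hf hex hg i) (post N (i + 1) f) := by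
  intro e
  constructor
  · intro h
    obtain ⟨x, hx⟩ := Abelian.Ext.covariant_sequence_exact₁ _ (sc_shortExact hf hex hg) e h rfl
    exact ⟨x, hx⟩
  · rintro ⟨x, rfl⟩
    simp only [cov, post, LinearMap.coe_mk, AddHom.coe_mk]
    rw [Abelian.Ext.comp_assoc _ _ _ rfl (add_zero 1) (by omega)]
    erw [(sc_shortExact hf hex hg).extClass_comp]
    simp

lemma pre_cov (i : ℕ) (h : N →ₗ[R] N') (e : ExtMod R N' M'' i) :
    pre M (i + 1) h (cov N' hf hex hg i e) = cov N hf hex hg i (pre M'' i h e) := by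
  simp only [cov, pre, LinearMap.coe_mk, AddHom.coe_mk]
  rw [Abelian.Ext.comp_assoc]
  omega

variable (N) in
/-- The contravariant connecting map. -/
noncomputable def con (i : ℕ) : ExtMod R M N i →ₗ[R] ExtMod R M'' N (i + 1) where
  toFun e := (sc_shortExact hf hex hg).extClass.comp e (add_comm 1 i)
  map_add' := by simp
  map_smul' := by simp

include hf hex hg in
lemma pre_exact (i : ℕ) : Function.Exact (pre N i g) (pre N i f) := by
  intro e
  constructor
  · intro h
    obtain ⟨x, hx⟩ := Abelian.Ext.contravariant_sequence_exact₂ (sc_shortExact hf hex hg) _ e h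
    exact ⟨x, hx⟩
  · rintro ⟨x, rfl⟩
    rw [pre_pre, show g ∘ₗ f = 0 from LinearMap.ext hex.apply_apply_eq_zero, pre_zero]

lemma pre_con_exact (i : ℕ) : Function.Exact (pre N i f) (con N hf hex hg i) := by
  intro e
  constructor
  · intro h
    obtain ⟨x, hx⟩ := Abelian.Ext.contravariant_sequence_exact₁ (sc_shortExact hf hex hg) _ e
      (add_comm 1 i) h
    exact ⟨x, hx⟩
  · rintro ⟨x, rfl⟩
    simp only [con, pre, LinearMap.coe_mk, AddHom.coe_mk]
    rw [← Abelian.Ext.comp_assoc _ _ _ (add_zero 1) (zero_add i) (by omega)]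
    erw [(sc_shortExact hf hex hg).extClass_comp]
    simp

lemma con_pre_exact (i : ℕ) : Function.Exact (con N hf hex hg i) (pre N (i + 1) g) := by
  intro e
  constructor
  · intro h
    obtain ⟨x, hx⟩ := Abelian.Ext.contravariant_sequence_exact₃ (sc_shortExact hf hex hg) _ e h
      (add_comm 1 i)
    exact ⟨x, hx⟩
  · rintro ⟨x, rfl⟩
    simp only [con, pre, LinearMap.coe_mk, AddHom.coe_mk]
    rw [← Abelian.Ext.comp_assoc _ _ _ (zero_add 1) (add_comm 1 i) (by omega)]
    erw [(sc_shortExact hf hex hg).comp_extClass]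
    simp

/-- Naturality of the contravariant connecting map. -/
lemma pre_con {L L' L'' : Type u} [AddCommGroup L] [Module R L] [AddCommGroup L'] [Module R L']
    [AddCommGroup L''] [Module R L''] {f' : L →ₗ[R] L'} {g' : L' →ₗ[R] L''}
    (hf' : Function.Injective f') (hex' : Function.Exact f' g') (hg' : Function.Surjective g')
    (a : L →ₗ[R] M) (b : L' →ₗ[R] M') (c : L'' →ₗ[R] M'') (h1 : b ∘ₗ f' = f ∘ₗ a)
    (h2 : c ∘ₗ g' = g ∘ₗ b) (i : ℕ) (e : ExtMod R M N i) :
    pre N (i + 1) c (con N hf hex hg i e) = con N hf' hex' hg' i (pre N i a e) := by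
  have := ShortComplex.ShortExact.extClass_naturality (sc_shortExact hf' hex' hg')
    (sc_shortExact hf hex hg)
    { τ₁ := ModuleCat.ofHom a, τ₂ := ModuleCat.ofHom b, τ₃ := ModuleCat.ofHom c
      comm₁₂ := ModuleCat.hom_ext h1.symm
      comm₂₃ := ModuleCat.hom_ext h2.symm }
  simp only [con, pre, LinearMap.coe_mk, AddHom.coe_mk]
  rw [← Abelian.Ext.comp_assoc _ _ _ (zero_add 1) (add_comm 1 i) (by omega),
    ← Abelian.Ext.comp_assoc _ _ _ (add_zero 1) (zero_add i) (by omega)]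
  congr 1
  exact this.symm

end LES
end ExtMod

end

section
universe u
open CategoryTheory TensorProduct

namespace ExtMod
variable {R : Type u} [CommRing R]
variable {N N' N'' M M' M'' : Type u} [AddCommGroup N] [Module R N] [AddCommGroup N'] [Module R N']
  [AddCommGroup N''] [Module R N''] [AddCommGroup M] [Module R M] [AddCommGroup M'] [Module R M']
  [AddCommGroup M''] [Module R M'']

lemma pre_smul_id (i : ℕ) (r : R) (e : ExtMod R N M i) :
    pre M i (r • LinearMap.id) e = r • e := by
  rw [pre_smul, pre_id]

lemma smul_eq_zero_of_left (r : R) (h : ∀ x : N, r • x = 0) (i : ℕ) (e : ExtMod R N M i) :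
    r • e = 0 := by
  rw [← pre_smul_id, show r • (LinearMap.id : N →ₗ[R] N) = 0 from LinearMap.ext h, pre_zero]

lemma pre_bijective (e : N ≃ₗ[R] N') (i : ℕ) :
    Function.Bijective (pre M i (e : N →ₗ[R] N')) := by
  refine Function.bijective_iff_has_inverse.2 ⟨pre M i (e.symm : N' →ₗ[R] N),
    fun a => ?_, fun a => ?_⟩
  · rw [pre_pre, show (e : N →ₗ[R] N') ∘ₗ (e.symm : N' →ₗ[R] N) = LinearMap.id from
      LinearMap.ext fun x => e.apply_symm_apply x, pre_id]
  · rw [pre_pre, show (e.symm : N' →ₗ[R] N) ∘ₗ (e : N →ₗ[R] N') = LinearMap.id from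
      LinearMap.ext fun x => e.symm_apply_apply x, pre_id]

lemma subsingleton_of_equiv (e : N ≃ₗ[R] N') (i : ℕ) [Subsingleton (ExtMod R N' M i)] :
    Subsingleton (ExtMod R N M i) :=
  (pre_bijective (M := M) e i).surjective.subsingleton

section LES
variable {f : M →ₗ[R] M'} {g : M' →ₗ[R] M''}
variable (hf : Function.Injective f) (hex : Function.Exact f g) (hg : Function.Surjective g)
include hf hex hg

omit hex hg in
lemma post_injective_zero : Function.Injective (post N 0 f) := by
  rw [injective_iff_map_eq_zero]
  intro e he
  obtain ⟨h, rfl⟩ := homEquiv.surjective e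
  rw [post_homEquiv] at he
  have : f ∘ₗ h = 0 := homEquiv.injective (he.trans (map_zero _).symm)
  rw [show h = 0 from LinearMap.ext fun x => hf (by simpa using LinearMap.congr_fun this x),
    map_zero]

lemma post_injective (i : ℕ) [Subsingleton (ExtMod R N M'' i)] :
    Function.Injective (post N (i + 1) f) := by
  rw [injective_iff_map_eq_zero]
  intro e he
  obtain ⟨y, rfl⟩ := (cov_post_exact hf hex hg i e).1 he
  rw [Subsingleton.elim y 0, map_zero]

lemma post_surjective (i : ℕ) [Subsingleton (ExtMod R N M (i + 1))] :
    Function.Surjective (post N i g) := fun e =>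
  (post_cov_exact hf hex hg i e).1 (Subsingleton.elim _ _)

lemma subsingleton_post_right (i : ℕ) [Subsingleton (ExtMod R N M' i)]
    [Subsingleton (ExtMod R N M (i + 1))] : Subsingleton (ExtMod R N M'' i) :=
  (post_surjective hf hex hg i).subsingleton

lemma subsingleton_post_left (i : ℕ) [Subsingleton (ExtMod R N M'' i)]
    [Subsingleton (ExtMod R N M' (i + 1))] : Subsingleton (ExtMod R N M (i + 1)) :=
  (post_injective hf hex hg i).subsingleton

omit hf hex in
lemma pre_injective_zero : Function.Injective (pre N 0 g) := by
  rw [injective_iff_map_eq_zero]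
  intro e he
  obtain ⟨h, rfl⟩ := homEquiv.surjective e
  rw [pre_homEquiv] at he
  have : h ∘ₗ g = 0 := homEquiv.injective (he.trans (map_zero _).symm)
  rw [show h = 0 from LinearMap.ext fun x => by
    obtain ⟨y, rfl⟩ := hg x; simpa using LinearMap.congr_fun this y, map_zero]

lemma pre_injective (i : ℕ) [Subsingleton (ExtMod R M N i)] :
    Function.Injective (pre N (i + 1) g) := by
  rw [injective_iff_map_eq_zero]
  intro e he
  obtain ⟨y, rfl⟩ := (con_pre_exact hf hex hg i e).1 he
  rw [Subsingleton.elim y 0, map_zero]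

lemma pre_surjective (i : ℕ) [Subsingleton (ExtMod R M'' N (i + 1))] :
    Function.Surjective (pre N i f) := fun e =>
  (pre_con_exact hf hex hg i e).1 (Subsingleton.elim _ _)

lemma subsingleton_pre_mid (i : ℕ) [Subsingleton (ExtMod R M N i)]
    [Subsingleton (ExtMod R M'' N i)] : Subsingleton (ExtMod R M' N i) := by
  refine subsingleton_of_forall_eq 0 fun e => ?_
  obtain ⟨y, rfl⟩ := (pre_exact hf hex hg i e).1 (Subsingleton.elim _ _)
  rw [Subsingleton.elim y 0, map_zero]

lemma subsingleton_pre_left (i : ℕ) [Subsingleton (ExtMod R M' N i)]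
    [Subsingleton (ExtMod R M'' N (i + 1))] : Subsingleton (ExtMod R M N i) :=
  (pre_surjective hf hex hg i).subsingleton

lemma subsingleton_pre_right (i : ℕ) [Subsingleton (ExtMod R M N i)]
    [Subsingleton (ExtMod R M' N (i + 1))] : Subsingleton (ExtMod R M'' N (i + 1)) :=
  (pre_injective hf hex hg i).subsingleton

end LES

section Regular
open Pointwise
variable {x : R}

lemma smul_injective (hx : IsSMulRegular M x) :
    Function.Injective (x • (LinearMap.id : M →ₗ[R] M)) := hx

lemma smul_mkQ_exact (x : R) :
    Function.Exact (x • (LinearMap.id : M →ₗ[R] M)) (x • (⊤ : Submodule R M)).mkQ := by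
  intro y
  simp only [Submodule.mkQ_apply, Submodule.Quotient.mk_eq_zero]
  constructor
  · rintro ⟨z, -, rfl⟩
    exact ⟨z, rfl⟩
  · rintro ⟨z, rfl⟩
    exact ⟨z, trivial, rfl⟩

/-- Modules killed by a power of an ideal have no `Ext` below the length of a regular sequence
contained in that ideal. -/
lemma subsingleton_of_isWeaklyRegular (J : Ideal R) {s : ℕ} (hN : ∀ r ∈ J ^ s, ∀ y : N, r • y = 0)
    (rs : List R) (hrs : ∀ r ∈ rs, r ∈ J) (hM : RingTheory.Sequence.IsWeaklyRegular M rs) :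
    ∀ i < rs.length, Subsingleton (ExtMod R N M i) := by
  induction rs generalizing M with
  | nil => simp
  | cons x rs ih =>
    rw [RingTheory.Sequence.isWeaklyRegular_cons_iff] at hM
    have ih' := ih (fun r hr => hrs r (List.mem_cons_of_mem _ hr)) hM.2
    intro i hi
    have inj : Function.Injective (post N i (x • (LinearMap.id : M →ₗ[R] M))) := by
      cases i with
      | zero => exact post_injective_zero (smul_injective hM.1)
      | succ i =>
        have : Subsingleton (ExtMod R N (QuotSMulTop x M) i) := ih' i (by simpa using hi)
        exact post_injective (smul_injective hM.1) (smul_mkQ_exact x)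
          (Submodule.mkQ_surjective _) i
    have key : ∀ k (e : ExtMod R N M i), x ^ k • e = 0 → e = 0 := by
      intro k
      induction k with
      | zero => simp
      | succ k ihk =>
        intro e he
        refine ihk e (inj ?_)
        rw [post_smul_id, smul_smul, ← pow_succ', he, map_zero]
    refine subsingleton_of_forall_eq 0 fun e => key s e (smul_eq_zero_of_left _ (fun y => ?_) i e)
    exact hN _ (Ideal.pow_mem_pow (hrs x (by simp)) s) y

end Regular
end ExtMod

end

section
universe u
open CategoryTheory TensorProduct

section
variable {R : Type u} [CommRing R]

/-- `H` is the increasing union of the modules `Ext^i(R/I^n, M)`. -/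
structure IsExtUnion (I : Ideal R) (i : ℕ) (M H : Type u) [AddCommGroup M] [Module R M]
    [AddCommGroup H] [Module R H] (ι : ∀ n : ℕ, ExtMod R (R ⧸ I ^ n) M i →ₗ[R] H) : Prop where
  compat : ∀ n N (h : n ≤ N) (e : ExtMod R (R ⧸ I ^ n) M i),
    ι N (ExtMod.pre M i (Submodule.factor (Ideal.pow_le_pow_right h)) e) = ι n e
  surj : ∀ h : H, ∃ n e, ι n e = h
  inj : ∀ n, Function.Injective (ι n)

lemma pre_factor_injective {M : Type u} [AddCommGroup M] [Module R M] (I : Ideal R)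
    (rs : List R) (hrs : ∀ r ∈ rs, r ∈ I) (hM : RingTheory.Sequence.IsWeaklyRegular M rs)
    {n N : ℕ} (h : n ≤ N) : Function.Injective (ExtMod.pre M rs.length
      (Submodule.factor (Ideal.pow_le_pow_right h : I ^ N ≤ I ^ n))) := by
  have hg : Function.Surjective (Submodule.factor (Ideal.pow_le_pow_right h : I ^ N ≤ I ^ n)) :=
    Submodule.factor_surjective _
  rcases hi : rs.length with _ | i
  · exact ExtMod.pre_injective_zero hg
  · have := ExtMod.subsingleton_of_isWeaklyRegular (M := M)
      (N := LinearMap.ker (Submodule.factor (Ideal.pow_le_pow_right h : I ^ N ≤ I ^ n))) I (s := N)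
      (fun r hr y => Subtype.ext ?_) rs hrs hM i (by omega)
    · exact ExtMod.pre_injective (Submodule.subtype_injective _)
        (LinearMap.exact_subtype_ker_map _) hg i
    · obtain ⟨z, hz⟩ := Ideal.Quotient.mk_surjective y.1
      rw [Submodule.coe_smul, ← hz]
      change Ideal.Quotient.mk _ (r * z) = 0
      exact Ideal.Quotient.eq_zero_iff_mem.2 (Ideal.mul_mem_right _ _ hr)

lemma IsExtColimit.isExtUnion {I : Ideal R} {M : ModuleCat.{u} R} {H : ModuleCat.{u} R}
    {rs : List R} (hrs : ∀ r ∈ rs, r ∈ I) (hM : RingTheory.Sequence.IsWeaklyRegular M rs)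
    {ι : ∀ n : ℕ, Abelian.Ext (ModuleCat.of R (R ⧸ I ^ n)) M rs.length →ₗ[R] H}
    (h : IsExtColimit I rs.length M H ι) : IsExtUnion I rs.length M H ι where
  compat := h.compat
  surj := h.surj
  inj n := by
    rw [injective_iff_map_eq_zero]
    intro e he
    obtain ⟨N, hN, h0⟩ := h.zero n e he
    exact pre_factor_injective I rs hrs hM hN (h0.trans (map_zero _).symm)

lemma exists_isExtUnion {I : Ideal R} (M : ModuleCat.{u} R) {d : ℕ}
    {rs : List R} (hl : rs.length = d) (hrs : ∀ r ∈ rs, r ∈ I)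
    (hM : RingTheory.Sequence.IsWeaklyRegular M rs) :
    ∃ ι, IsExtUnion I d M ((localCohomology I d).obj M) ι := by
  subst hl
  obtain ⟨ι, hι⟩ := exists_isExtColimit_localCohomology I rs.length M
  exact ⟨ι, hι.isExtUnion hrs hM⟩

end

section
open IsLocalRing
variable {R : Type u} [CommRing R] [IsNoetherianRing R] [IsLocalRing R]

omit [IsNoetherianRing R] in
lemma support_quot_maximalIdeal :
    Module.support R (R ⧸ maximalIdeal R ^ 1) = PrimeSpectrum.zeroLocus (maximalIdeal R) := by
  rw [Module.support_eq_zeroLocus, Ideal.annihilator_quotient, pow_one]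

lemma exists_isRegular_of_ext (t : ℕ) (n : ℕ) (hn : n ≠ 0)
    (h : ∀ i < t, Subsingleton (ExtMod R (R ⧸ maximalIdeal R ^ 1) R i)) :
    ∃ rs : List R, rs.length = t ∧ (∀ r ∈ rs, r ∈ maximalIdeal R ^ n) ∧
      RingTheory.Sequence.IsRegular R rs := by
  refine ModuleCat.exists_isRegular_of_exists_subsingleton_ext (maximalIdeal R ^ n) t
    (ModuleCat.of R R) ?_ (ModuleCat.of R (R ⧸ maximalIdeal R ^ 1)) ?_ h
  · change maximalIdeal R ^ n • (⊤ : Submodule R R) < ⊤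
    rw [smul_eq_mul, Ideal.mul_top, lt_top_iff_ne_top]
    exact fun h => (maximalIdeal.isMaximal R).ne_top (top_le_iff.1 (h ▸ Ideal.pow_le_self hn))
  · change Module.support R (R ⧸ maximalIdeal R ^ 1) = _
    rw [support_quot_maximalIdeal, PrimeSpectrum.zeroLocus_pow _ hn]

lemma IsCohenMacaulayLocalRing.subsingleton_ext (hCM : IsCohenMacaulayLocalRing R) {d : ℕ}
    (hdim : ringKrullDim R = (d : WithBot ℕ∞)) (t : ℕ) (ht : t ≤ d) :
    ∀ i < t, Subsingleton (ExtMod R (R ⧸ maximalIdeal R ^ 1) R i) := by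
  induction t with
  | zero => simp
  | succ t ih =>
    have ih := ih (by omega)
    intro i hi
    rcases Nat.lt_succ_iff_lt_or_eq.1 hi with hi | rfl
    · exact ih i hi
    obtain ⟨rs, hl, hrs, hreg⟩ := exists_isRegular_of_ext i 1 one_ne_zero ih
    obtain ⟨ι, hι⟩ := exists_isExtUnion (I := maximalIdeal R) (ModuleCat.of R R) hl
      (by simpa using hrs) hreg.toIsWeaklyRegular
    have := hCM i (by rw [hdim]; exact_mod_cast (by omega : i ≠ d))
    exact (hι.inj 1).subsingleton

/-- Maximal regular sequences in a Cohen-Macaulay local ring, deep inside the maximal ideal. -/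
lemma IsCohenMacaulayLocalRing.exists_isRegular (hCM : IsCohenMacaulayLocalRing R) {d : ℕ}
    (hdim : ringKrullDim R = (d : WithBot ℕ∞)) (n : ℕ) (hn : n ≠ 0) :
    ∃ rs : List R, rs.length = d ∧ (∀ r ∈ rs, r ∈ maximalIdeal R ^ n) ∧
      RingTheory.Sequence.IsRegular R rs :=
  exists_isRegular_of_ext d n hn (hCM.subsingleton_ext hdim d le_rfl)

lemma exists_pow_le_ofList {d : ℕ} (hdim : ringKrullDim R = (d : WithBot ℕ∞)) {rs : List R}
    (hl : rs.length = d) (hreg : RingTheory.Sequence.IsRegular R rs) :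
    ∃ s, maximalIdeal R ^ s ≤ Ideal.ofList rs := by
  have h1 := ringKrullDim_add_length_eq_ringKrullDim_of_isRegular rs hreg
  have hne : Ideal.ofList rs ≠ ⊤ := fun h => hreg.top_ne_smul (by simp [h])
  have : Nontrivial (R ⧸ Ideal.ofList rs) := Ideal.Quotient.nontrivial_iff.2 hne
  have h0 : ringKrullDim (R ⧸ Ideal.ofList rs) ≤ 0 := by
    rw [hdim, hl] at h1
    by_contra hlt
    have h2 := not_le.1 hlt
    generalize ringKrullDim (R ⧸ Ideal.ofList rs) = k at h1 h2
    cases k with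
    | bot => exact absurd h2 (by simp)
    | coe k =>
      cases k with
      | top =>
        have h1 : (⊤ + d : ℕ∞) = d := by exact_mod_cast h1
        simp at h1
      | coe k =>
        have h1 : k + d = d := by exact_mod_cast h1
        have h2 : 0 < k := by exact_mod_cast h2
        omega
  have : Ring.KrullDimLE 0 (R ⧸ Ideal.ofList rs) := Order.krullDimLE_iff _ _ |>.2 h0
  have : IsArtinianRing (R ⧸ Ideal.ofList rs) := isArtinianRing_iff_krullDimLE_zero.2 this
  exact exists_maximalIdeal_pow_le_of_isArtinianRing_quotient _
end

end

section
universe u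
open CategoryTheory TensorProduct

open Pointwise
variable {R : Type u} [CommRing R]

lemma exists_comp_eq_of_ext {N M M' M'' : Type u} [AddCommGroup N] [Module R N] [AddCommGroup M]
    [Module R M] [AddCommGroup M'] [Module R M'] [AddCommGroup M''] [Module R M'']
    {f : M →ₗ[R] M'} {g : M' →ₗ[R] M''} (hf : Function.Injective f) (hex : Function.Exact f g)
    (hg : Function.Surjective g) [Subsingleton (ExtMod R N M 1)] (h : N →ₗ[R] M'') :
    ∃ h' : N →ₗ[R] M', g ∘ₗ h' = h := by
  obtain ⟨e, he⟩ := ExtMod.post_surjective (N := N) hf hex hg 0 (ExtMod.homEquiv h)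
  obtain ⟨h', rfl⟩ := ExtMod.homEquiv.surjective e
  exact ⟨h', ExtMod.homEquiv.injective (by rw [← he, ExtMod.post_homEquiv])⟩

/-- If `A ≅ Hom(C, D)` and `Ext^i(C, D) = 0` for `i ≥ 1`, with `C` faithful, then a sequence
regular on `A` is regular on `D`, and the isomorphism descends to the quotients. -/
lemma isWeaklyRegular_of_bijective_hom [IsNoetherianRing R] (C : Type u) [AddCommGroup C]
    [Module R C] [Module.Finite R C] (hC : Module.annihilator R C = ⊥) (rs : List R)
    (A D : Type u) [AddCommGroup A] [Module R A] [AddCommGroup D] [Module R D] [Module.Finite R D]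
    (φ : A →ₗ[R] C →ₗ[R] D) (hφ : Function.Bijective φ)
    (hext : ∀ i, Subsingleton (ExtMod R C D (i + 1)))
    (hrs : RingTheory.Sequence.IsWeaklyRegular A rs) :
    RingTheory.Sequence.IsWeaklyRegular D rs ∧
      (∀ f : C →ₗ[R] D ⧸ (Ideal.ofList rs • ⊤ : Submodule R D), ∃ a,
        f = Submodule.mkQ _ ∘ₗ φ a) ∧
      ∀ a, (∀ c, φ a c ∈ (Ideal.ofList rs • ⊤ : Submodule R D)) →
        a ∈ (Ideal.ofList rs • ⊤ : Submodule R A) := by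
  induction rs generalizing A D with
  | nil =>
    refine ⟨.nil _ _, fun f => ?_, fun a ha => ?_⟩
    · have hbot : (Ideal.ofList ([] : List R) • ⊤ : Submodule R D) = ⊥ := by simp
      let e := Submodule.quotEquivOfEqBot _ hbot
      obtain ⟨a, ha⟩ := hφ.2 (e.toLinearMap ∘ₗ f)
      refine ⟨a, LinearMap.ext fun c => e.injective ?_⟩
      rw [ha]
      exact (Submodule.quotEquivOfEqBot_apply_mk _ hbot _).symm
    · have : φ a = 0 := LinearMap.ext fun c => by simpa using ha c
      rw [hφ.1 (this.trans (map_zero φ).symm)]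
      exact zero_mem _
  | cons x rs ih =>
    rw [RingTheory.Sequence.isWeaklyRegular_cons_iff] at hrs
    have hx : IsSMulRegular D x := by
      let N := LinearMap.ker (x • (LinearMap.id : D →ₗ[R] D))
      have : Subsingleton (C →ₗ[R] N) := by
        refine subsingleton_of_forall_eq 0 fun f => ?_
        obtain ⟨a, ha⟩ := hφ.2 (N.subtype ∘ₗ f)
        have h0 : φ (x • a) = φ 0 := by
          rw [map_smul, ha, map_zero]
          exact LinearMap.ext fun c => (f c).2
        have h1 : a = 0 := hrs.1 (by simpa using hφ.1 h0)
        rw [h1, map_zero] at ha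
        exact LinearMap.ext fun c => Subtype.ext (LinearMap.congr_fun ha c).symm
      obtain ⟨r, hr, hreg⟩ := IsSMulRegular.subsingleton_linearMap_iff.1 this
      rw [hC, Submodule.mem_bot] at hr
      subst hr
      have hN : Subsingleton N := ⟨fun a b => hreg (by simp)⟩
      refine (LinearMap.ker_eq_bot (f := x • (LinearMap.id : D →ₗ[R] D))).1 ?_
      exact (Submodule.subsingleton_iff_eq_bot).1 hN
    have h1 := hext 0
    have inj := ExtMod.smul_injective hx
    have ex := ExtMod.smul_mkQ_exact (M := D) x
    have sur := Submodule.mkQ_surjective (x • (⊤ : Submodule R D))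
    let φ₀ : A →ₗ[R] C →ₗ[R] QuotSMulTop x D := (Submodule.mkQ (x • ⊤)).compRight R ∘ₗ φ
    have hφ₀ : x • (⊤ : Submodule R A) ≤ LinearMap.ker φ₀ := by
      rintro _ ⟨a, -, rfl⟩
      refine LinearMap.ext fun c => (Submodule.Quotient.mk_eq_zero _).2 ?_
      exact ⟨φ a c, trivial, by simp⟩
    let φ' : QuotSMulTop x A →ₗ[R] C →ₗ[R] QuotSMulTop x D := Submodule.liftQ _ φ₀ hφ₀
    have key : Function.Bijective φ' := by
      constructor
      · rw [injective_iff_map_eq_zero]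
        intro a ha
        obtain ⟨a, rfl⟩ := Submodule.Quotient.mk_surjective _ a
        have hz : ∀ c, ∃ y, x • y = φ a c := fun c => (ex _).1 (LinearMap.congr_fun ha c)
        choose y hy using hz
        let h : C →ₗ[R] D :=
          { toFun := y
            map_add' := fun c c' => hx (by simp [hy])
            map_smul' := fun r c => hx (by simp [hy, smul_comm x r]) }
        obtain ⟨b, hb⟩ := hφ.2 h
        refine (Submodule.Quotient.mk_eq_zero _).2 ⟨b, trivial, hφ.1 ?_⟩
        refine LinearMap.ext fun c => ?_
        simp [hb, h, hy]
      · intro f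
        obtain ⟨h, hh⟩ := exists_comp_eq_of_ext inj ex sur f
        obtain ⟨a, ha⟩ := hφ.2 h
        exact ⟨Submodule.Quotient.mk a, by rw [← hh, ← ha]; rfl⟩
    have hext' : ∀ i, Subsingleton (ExtMod R C (QuotSMulTop x D) (i + 1)) := fun i =>
      have := hext i
      have := hext (i + 1)
      ExtMod.subsingleton_post_right inj ex sur (i + 1)
    obtain ⟨r1, r2, r3⟩ := ih (QuotSMulTop x A) (QuotSMulTop x D) φ' key hext' hrs.2
    refine ⟨(RingTheory.Sequence.isWeaklyRegular_cons_iff _ _ _).2 ⟨hx, r1⟩, fun f => ?_,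
      fun a ha => ?_⟩
    · let e := Submodule.quotOfListConsSMulTopEquivQuotSMulTopInner D x rs
      obtain ⟨a, ha⟩ := r2 (e.toLinearMap ∘ₗ f)
      obtain ⟨a, rfl⟩ := Submodule.Quotient.mk_surjective _ a
      refine ⟨a, LinearMap.ext fun c => e.injective ?_⟩
      exact LinearMap.congr_fun ha c
    · let e := Submodule.quotOfListConsSMulTopEquivQuotSMulTopInner A x rs
      let e' := Submodule.quotOfListConsSMulTopEquivQuotSMulTopInner D x rs
      have := r3 (Submodule.Quotient.mk a) fun c => by
        rw [← Submodule.Quotient.mk_eq_zero]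
        have h2 := (Submodule.Quotient.mk_eq_zero _).2 (ha c)
        have := congrArg e' h2
        rw [map_zero] at this
        exact this
      rw [← Submodule.Quotient.mk_eq_zero] at this ⊢
      apply e.injective
      rw [map_zero]
      exact this

end

section
universe u
open CategoryTheory TensorProduct

open Pointwise
variable {R : Type u} [CommRing R] [IsNoetherianRing R]

omit [IsNoetherianRing R] in
lemma pre_eq_zero_of_forall_mem {A B T : Type u} [AddCommGroup A] [Module R A] [AddCommGroup B]
    [Module R B] [AddCommGroup T] [Module R T] {j : ℕ} (S : Submodule R B) (e : ExtMod R B T j)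
    (he : ExtMod.pre T j S.subtype e = 0) (a : A →ₗ[R] B) (ha : ∀ y, a y ∈ S) :
    ExtMod.pre T j a e = 0 := by
  have h := ExtMod.pre_pre j (a.codRestrict S ha) S.subtype e
  rw [he, map_zero, LinearMap.subtype_comp_codRestrict] at h
  exact h.symm

/-- Classes in `Ext^j(P, T)` with `T` torsion vanish on a deep submodule `I^N P`. -/
lemma exists_pre_subtype_eq_zero (I : Ideal R) (T : Type u) [AddCommGroup T] [Module R T] {s : ℕ}
    (hT : ∀ r ∈ I ^ s, ∀ y : T, r • y = 0) (j : ℕ) (P : Type u) [AddCommGroup P] [Module R P]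
    [Module.Finite R P] (e : ExtMod R P T j) :
    ∃ N : ℕ, ExtMod.pre T j (I ^ N • ⊤ : Submodule R P).subtype e = 0 := by
  induction j generalizing P with
  | zero =>
    obtain ⟨h, rfl⟩ := ExtMod.homEquiv.surjective e
    refine ⟨s, ?_⟩
    rw [ExtMod.pre_homEquiv, ← map_zero ExtMod.homEquiv]
    congr 1
    refine LinearMap.ext fun y => ?_
    have : (I ^ s • ⊤ : Submodule R P) ≤ LinearMap.ker h := by
      rw [Submodule.smul_le]
      intro r hr z _
      rw [LinearMap.mem_ker, map_smul, hT r hr]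
    exact this y.2
  | succ j ih =>
    obtain ⟨n, p, hp⟩ := Module.Finite.exists_fin' R P
    have := ExtMod.subsingleton_of_projective (R := R) (N := Fin n → R) (M := T) j
    let K := LinearMap.ker p
    obtain ⟨e', rfl⟩ := (ExtMod.con_pre_exact (N := T) K.subtype_injective
      (LinearMap.exact_subtype_ker_map p) hp j e).1 (Subsingleton.elim _ _)
    obtain ⟨N, hN⟩ := ih K e'
    obtain ⟨k, hk⟩ := I.exists_pow_inf_eq_pow_smul K
    let F' : Submodule R (Fin n → R) := I ^ (N + k) • ⊤
    have hF' : F' ⊓ K ≤ I ^ N • K := by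
      rw [hk (N + k) (by omega), Nat.add_sub_cancel]
      exact Submodule.smul_mono le_rfl inf_le_right
    have hmap : F'.map p = I ^ (N + k) • ⊤ := by
      rw [Submodule.map_smul'', Submodule.map_top, LinearMap.range_eq_top.2 hp]
    let g' : F' →ₗ[R] (I ^ (N + k) • ⊤ : Submodule R P) :=
      p.restrict fun y hy => hmap ▸ Submodule.mem_map_of_mem hy
    have hf' : Function.Injective (Submodule.inclusion (inf_le_left : F' ⊓ K ≤ F')) :=
      Submodule.inclusion_injective _
    have hg' : Function.Surjective g' := by
      rintro ⟨y, hy⟩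
      rw [← hmap] at hy
      obtain ⟨z, hz, rfl⟩ := hy
      exact ⟨⟨z, hz⟩, rfl⟩
    have hex' : Function.Exact (Submodule.inclusion (inf_le_left : F' ⊓ K ≤ F')) g' := by
      intro y
      constructor
      · intro h
        exact ⟨⟨y, y.2, congrArg Subtype.val h⟩, rfl⟩
      · rintro ⟨z, rfl⟩
        exact Subtype.ext z.2.2
    refine ⟨N + k, ?_⟩
    rw [ExtMod.pre_con _ _ _ hf' hex' hg' (Submodule.inclusion inf_le_right) F'.subtype _ rfl rfl]
    have hle : ∀ y : ↥(F' ⊓ K), (Submodule.inclusion inf_le_right y : K) ∈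
        (I ^ N • ⊤ : Submodule R K) := by
      intro y
      have h1 := hF' y.2
      rw [show I ^ N • K = (I ^ N • ⊤ : Submodule R K).map K.subtype by
        rw [Submodule.map_smul'', Submodule.map_top, Submodule.range_subtype]] at h1
      obtain ⟨z, hz, hzy⟩ := h1
      rwa [show Submodule.inclusion inf_le_right y = z from Subtype.ext hzy.symm]
    rw [pre_eq_zero_of_forall_mem _ _ hN _ hle, map_zero]

/-- Every class in `Ext^i(R/I^n, M)` dies in some `Ext^i(R/I^N, M)`. -/
def ExtVanishes (I : Ideal R) (i : ℕ) (M : Type u) [AddCommGroup M] [Module R M] : Prop :=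
  ∀ n (e : ExtMod R (R ⧸ I ^ n) M i), ∃ N, ∃ h : n ≤ N,
    ExtMod.pre M i (Submodule.factor (Ideal.pow_le_pow_right h)) e = 0

lemma extVanishes_of_torsion (I : Ideal R) (T : Type u) [AddCommGroup T] [Module R T] {s : ℕ}
    (hT : ∀ r ∈ I ^ s, ∀ y : T, r • y = 0) (j : ℕ) : ExtVanishes I (j + 1) T := by
  intro n e
  have := ExtMod.subsingleton_of_projective (R := R) (N := R) (M := T) j
  have hex : ∀ n, Function.Exact (I ^ n).subtype (Submodule.mkQ (I ^ n)) := fun n =>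
    LinearMap.exact_subtype_mkQ _
  have sur : ∀ n, Function.Surjective (Submodule.mkQ (I ^ n)) := fun n =>
    Submodule.mkQ_surjective _
  have inj : ∀ n, Function.Injective (I ^ n).subtype := fun n => Submodule.subtype_injective _
  obtain ⟨e', rfl⟩ := (ExtMod.con_pre_exact (N := T) (inj n) (hex n) (sur n) j e).1
    (Subsingleton.elim _ _)
  obtain ⟨N, hN⟩ := exists_pre_subtype_eq_zero I T hT j _ e'
  have hle : I ^ (N + n) ≤ I ^ n := Ideal.pow_le_pow_right (by omega)
  refine ⟨N + n, by omega, ?_⟩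
  rw [ExtMod.pre_con _ _ _ (inj (N + n)) (hex _) (sur _) (Submodule.inclusion hle)
    LinearMap.id _ rfl rfl]
  have hmem : ∀ y, Submodule.inclusion hle y ∈ (I ^ N • ⊤ : Submodule R ↥(I ^ n)) := by
    intro y
    have h1 : ∀ z ∈ I ^ (N + n), z ∈ (I ^ N • ⊤ : Submodule R ↥(I ^ n)).map (I ^ n).subtype := by
      rw [Submodule.map_smul'', Submodule.map_top, Submodule.range_subtype, smul_eq_mul, ← pow_add]
      exact fun z hz => hz
    obtain ⟨z, hz, hzy⟩ := h1 y y.2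
    rwa [show Submodule.inclusion hle y = z from Subtype.ext hzy.symm]
  rw [pre_eq_zero_of_forall_mem _ _ hN _ hmem, map_zero]

omit [IsNoetherianRing R] in
lemma pre_factor_factor {I : Ideal R} {M : Type u} [AddCommGroup M] [Module R M] {i n N N' : ℕ}
    (h : n ≤ N) (h' : N ≤ N') (e : ExtMod R (R ⧸ I ^ n) M i) :
    ExtMod.pre M i (Submodule.factor (Ideal.pow_le_pow_right h'))
      (ExtMod.pre M i (Submodule.factor (Ideal.pow_le_pow_right h)) e) =
    ExtMod.pre M i (Submodule.factor (Ideal.pow_le_pow_right (h.trans h'))) e := by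
  rw [ExtMod.pre_pre, Submodule.factor_comp]

omit [IsNoetherianRing R] in
lemma ExtVanishes.succ {I : Ideal R} {i : ℕ} {M : Type u} [AddCommGroup M] [Module R M] {x : R}
    (hxI : x ∈ I) (hx : IsSMulRegular M x) (h : ExtVanishes I i (QuotSMulTop x M)) :
    ExtVanishes I (i + 1) M := by
  have inj := ExtMod.smul_injective hx
  have ex := ExtMod.smul_mkQ_exact (M := M) x
  have sur := Submodule.mkQ_surjective (x • (⊤ : Submodule R M))
  have key : ∀ k n (e : ExtMod R (R ⧸ I ^ n) M (i + 1)), x ^ k • e = 0 → ∃ N, ∃ h : n ≤ N,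
      ExtMod.pre M (i + 1) (Submodule.factor (Ideal.pow_le_pow_right h)) e = 0 := by
    intro k
    induction k with
    | zero => exact fun n e he => ⟨n, le_rfl, by rw [show e = 0 by simpa using he, map_zero]⟩
    | succ k ih =>
      intro n e he
      have h0 : ExtMod.post (R ⧸ I ^ n) (i + 1) (x • (LinearMap.id : M →ₗ[R] M))
            (x ^ k • e) = 0 := by
        rw [ExtMod.post_smul_id, smul_smul, ← pow_succ', he]
      obtain ⟨e', he'⟩ := (ExtMod.cov_post_exact inj ex sur i _).1 h0
      obtain ⟨N, hN, h1⟩ := h n e'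
      obtain ⟨N', hN', h2⟩ := ih N (ExtMod.pre M (i + 1)
        (Submodule.factor (Ideal.pow_le_pow_right hN)) e) (by
          rw [← map_smul, ← he', ExtMod.pre_cov, h1, map_zero])
      exact ⟨N', hN.trans hN', by rw [← pre_factor_factor hN hN', h2]⟩
  intro n e
  refine key n n e (ExtMod.smul_eq_zero_of_left _ (fun y => ?_) _ _)
  obtain ⟨z, rfl⟩ := Ideal.Quotient.mk_surjective y
  change Ideal.Quotient.mk _ (x ^ n * z) = 0
  exact Ideal.Quotient.eq_zero_iff_mem.2 (Ideal.mul_mem_right _ _ (Ideal.pow_mem_pow hxI n))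

omit [IsNoetherianRing R] in
lemma smul_top_quotSMulTop_le {M : Type u} [AddCommGroup M] [Module R M] {J : Ideal R} {x : R}
    {rs : List R} (h : J • (⊤ : Submodule R M) ≤ Ideal.ofList (x :: rs) • ⊤) :
    J • (⊤ : Submodule R (QuotSMulTop x M)) ≤ Ideal.ofList rs • ⊤ := by
  have h1 := Submodule.map_mono (f := (x • (⊤ : Submodule R M)).mkQ) h
  rw [Ideal.ofList_cons_smul, Submodule.map_sup, Submodule.mkQ_map_self, bot_sup_eq,
    Submodule.map_smul'', Submodule.map_smul'', Submodule.map_top, Submodule.range_mkQ] at h1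
  exact h1

lemma extVanishes_of_isWeaklyRegular (I : Ideal R) {s : ℕ} (rs : List R) (hrs : ∀ r ∈ rs, r ∈ I)
    (M : Type u) [AddCommGroup M] [Module R M] (hM : RingTheory.Sequence.IsWeaklyRegular M rs)
    (hT : I ^ s • (⊤ : Submodule R M) ≤ Ideal.ofList rs • ⊤) {i : ℕ} (hi : rs.length < i) :
    ExtVanishes I i M := by
  induction rs generalizing M i with
  | nil =>
    obtain ⟨j, rfl⟩ : ∃ j, i = j + 1 := ⟨i - 1, by simp at hi; omega⟩
    refine extVanishes_of_torsion I M (s := s) (fun r hr y => ?_) j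
    simpa using hT (Submodule.smul_mem_smul hr (Submodule.mem_top (x := y)))
  | cons x rs ih =>
    obtain ⟨j, rfl⟩ : ∃ j, i = j + 1 := ⟨i - 1, by simp at hi; omega⟩
    rw [RingTheory.Sequence.isWeaklyRegular_cons_iff] at hM
    refine ExtVanishes.succ (hrs x (by simp)) hM.1 (ih (fun r hr => hrs r (by simp [hr])) _ hM.2
      (smul_top_quotSMulTop_le hT) (by simpa using hi))

end

section
universe u
open CategoryTheory TensorProduct

open Pointwise
variable {R : Type u} [CommRing R]

lemma IsExtUnion.smul_surjective {I : Ideal R} {i : ℕ} {M H : Type u} [AddCommGroup M] [Module R M]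
    [AddCommGroup H] [Module R H] {ι : ∀ n : ℕ, ExtMod R (R ⧸ I ^ n) M i →ₗ[R] H}
    (h : IsExtUnion I i M H ι) {x : R} (hx : IsSMulRegular M x)
    (hv : ExtVanishes I i (QuotSMulTop x M)) (y : H) : ∃ z : H, x • z = y := by
  obtain ⟨n, e, rfl⟩ := h.surj y
  obtain ⟨N, hN, h0⟩ := hv n (ExtMod.post _ _ (Submodule.mkQ _) e)
  rw [ExtMod.pre_post] at h0
  obtain ⟨e', he'⟩ := (ExtMod.post_exact (ExtMod.smul_injective hx)
    (ExtMod.smul_mkQ_exact (M := M) x) (Submodule.mkQ_surjective _) i _).1 h0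
  rw [ExtMod.post_smul_id] at he'
  exact ⟨ι N e', by rw [← map_smul, he', h.compat n N hN]⟩

lemma IsExtUnion.exists_torsionBy {I : Ideal R} {i : ℕ} {M H : Type u} [AddCommGroup M]
    [Module R M] [AddCommGroup H] [Module R H]
    {ι : ∀ n : ℕ, ExtMod R (R ⧸ I ^ n) M (i + 1) →ₗ[R] H}
    (h : IsExtUnion I (i + 1) M H ι) {x : R} (hx : IsSMulRegular M x)
    (hv : ∀ n, Subsingleton (ExtMod R (R ⧸ I ^ n) M i)) :
    ∃ ι', IsExtUnion I i (QuotSMulTop x M) (Submodule.torsionBy R H x) ι' := by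
  have inj := ExtMod.smul_injective hx
  have ex := ExtMod.smul_mkQ_exact (M := M) x
  have sur := Submodule.mkQ_surjective (x • (⊤ : Submodule R M))
  have hmem : ∀ n (e : ExtMod R (R ⧸ I ^ n) (QuotSMulTop x M) i),
      ι n (ExtMod.cov _ inj ex sur i e) ∈ Submodule.torsionBy R H x := by
    intro n e
    rw [Submodule.mem_torsionBy_iff, ← map_smul, ← ExtMod.post_smul_id,
      (ExtMod.cov_post_exact inj ex sur i).apply_apply_eq_zero, map_zero]
  refine ⟨fun n => (ι n ∘ₗ ExtMod.cov _ inj ex sur i).codRestrict _ (hmem n), ?_, ?_, ?_⟩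
  · intro n N hN e
    refine Subtype.ext ?_
    change ι N (ExtMod.cov _ inj ex sur i (ExtMod.pre _ i _ e)) = ι n _
    rw [← ExtMod.pre_cov, h.compat n N hN]
  · rintro ⟨y, hy⟩
    obtain ⟨n, e, rfl⟩ := h.surj y
    rw [Submodule.mem_torsionBy_iff, ← map_smul] at hy
    have h0 := h.inj n (hy.trans (map_zero _).symm)
    rw [← ExtMod.post_smul_id] at h0
    obtain ⟨e', he'⟩ := (ExtMod.cov_post_exact inj ex sur i _).1 h0
    exact ⟨n, e', Subtype.ext (congrArg (ι n) he')⟩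
  · intro n
    rw [injective_iff_map_eq_zero]
    intro e he
    have h1 := h.inj n ((congrArg Subtype.val he).trans (map_zero (ι n)).symm)
    obtain ⟨e', rfl⟩ := (ExtMod.post_cov_exact inj ex sur i e).1 h1
    rw [Subsingleton.elim e' 0, map_zero]

lemma IsExtUnion.nonempty_equiv {I : Ideal R} {M H : Type u} [AddCommGroup M] [Module R M]
    [AddCommGroup H] [Module R H] {ι : ∀ n : ℕ, ExtMod R (R ⧸ I ^ n) M 0 →ₗ[R] H}
    (h : IsExtUnion I 0 M H ι) {s : ℕ} (hs : ∀ r ∈ I ^ s, ∀ y : M, r • y = 0) :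
    Nonempty (H ≃ₗ[R] M) := by
  let ψ₀ : M →ₗ[R] (R ⧸ I ^ s) →ₗ[R] M :=
    { toFun := fun y => Submodule.liftQ _ (LinearMap.toSpanSingleton R M y) fun r hr => hs r hr y
      map_add' := fun y z => Submodule.linearMap_qext _
          (LinearMap.ext_ring (smul_add (1 : R) y z))
      map_smul' := fun r z => Submodule.linearMap_qext _
          (LinearMap.ext_ring (smul_comm (1 : R) r z)) }
  have h1 : ∀ y, ψ₀ y (Submodule.Quotient.mk 1) = y := fun y => one_smul R y
  refine ⟨(LinearEquiv.ofBijective (ι s ∘ₗ ExtMod.homEquiv.toLinearMap ∘ₗ ψ₀) ⟨?_, ?_⟩).symm⟩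
  · refine (h.inj s).comp (ExtMod.homEquiv.injective.comp fun y z hyz => ?_)
    rw [← h1 y, hyz, h1]
  · intro y
    obtain ⟨n, e, rfl⟩ := h.surj y
    obtain ⟨f, rfl⟩ := ExtMod.homEquiv.surjective e
    refine ⟨f (Submodule.Quotient.mk 1), ?_⟩
    change ι s (ExtMod.homEquiv (ψ₀ _)) = _
    rw [← h.compat s (max s n) (le_max_left _ _), ← h.compat n (max s n) (le_max_right _ _),
      ExtMod.pre_homEquiv, ExtMod.pre_homEquiv]
    congr 2
    exact Submodule.linearMap_qext _
          (LinearMap.ext_ring (h1 _))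

/-- `H` is divisible by the elements of the list one after the other, and the elements
successively killed by the list form a module isomorphic to `K`. -/
def CoregTo : List R → (H : Type u) → [AddCommGroup H] → [Module R H] →
    (K : Type u) → [AddCommGroup K] → [Module R K] → Prop
  | [], H, _, _, K, _, _ => Nonempty (H ≃ₗ[R] K)
  | x :: rs, H, _, _, K, _, _ =>
    (∀ y : H, ∃ z : H, x • z = y) ∧ CoregTo rs (Submodule.torsionBy R H x) K

lemma CoregTo.trans_equiv {rs : List R} {H K K' : Type u} [AddCommGroup H] [Module R H]
    [AddCommGroup K] [Module R K] [AddCommGroup K'] [Module R K'] (h : CoregTo rs H K)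
    (e : K ≃ₗ[R] K') : CoregTo rs H K' := by
  induction rs generalizing H with
  | nil => exact h.map fun e' => e' ≪≫ₗ e
  | cons x rs ih => exact ⟨h.1, ih h.2⟩

lemma IsExtUnion.coregTo [IsNoetherianRing R] {I : Ideal R} {s : ℕ} (rs : List R)
    (hrs : ∀ r ∈ rs, r ∈ I)
    (M H : Type u) [AddCommGroup M] [Module R M] [AddCommGroup H] [Module R H]
    (hM : RingTheory.Sequence.IsWeaklyRegular M rs)
    (hT : I ^ s • (⊤ : Submodule R M) ≤ Ideal.ofList rs • ⊤)
    {ι : ∀ n : ℕ, ExtMod R (R ⧸ I ^ n) M rs.length →ₗ[R] H} (h : IsExtUnion I rs.length M H ι) :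
    CoregTo rs H (M ⧸ (Ideal.ofList rs • ⊤ : Submodule R M)) := by
  induction rs generalizing M H with
  | nil =>
    have hbot : (Ideal.ofList ([] : List R) • ⊤ : Submodule R M) = ⊥ := by simp
    obtain ⟨e⟩ := h.nonempty_equiv (s := s) (fun r hr y => by
      simpa using hT (Submodule.smul_mem_smul hr (Submodule.mem_top (x := y))))
    exact ⟨e ≪≫ₗ (Submodule.quotEquivOfEqBot _ hbot).symm⟩
  | cons x rs ih =>
    have hM' := (RingTheory.Sequence.isWeaklyRegular_cons_iff _ _ _).1 hM
    have hrs' : ∀ r ∈ rs, r ∈ I := fun r hr => hrs r (by simp [hr])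
    refine ⟨h.smul_surjective hM'.1 (extVanishes_of_isWeaklyRegular I rs hrs' _ hM'.2
      (smul_top_quotSMulTop_le hT) (by simp)), ?_⟩
    obtain ⟨ι', hι'⟩ := h.exists_torsionBy hM'.1 fun n =>
      ExtMod.subsingleton_of_isWeaklyRegular I (s := n) (fun r hr y => by
        obtain ⟨z, rfl⟩ := Ideal.Quotient.mk_surjective y
        change Ideal.Quotient.mk _ (r * z) = 0
        exact Ideal.Quotient.eq_zero_iff_mem.2 (Ideal.mul_mem_right _ _ hr)) (x :: rs) hrs hM _
        (by simp)
    exact (ih hrs' _ _ hM'.2 (smul_top_quotSMulTop_le hT) hι').trans_equiv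
      (Submodule.quotOfListConsSMulTopEquivQuotSMulTopInner M x rs).symm

/-- The top local cohomology of a module with a maximal regular sequence. -/
lemma coregTo_localCohomology [IsNoetherianRing R] {I : Ideal R} {s d : ℕ} (M : ModuleCat.{u} R)
    (rs : List R) (hl : rs.length = d) (hrs : ∀ r ∈ rs, r ∈ I)
    (hM : RingTheory.Sequence.IsWeaklyRegular M rs) (hs : I ^ s ≤ Ideal.ofList rs) :
    CoregTo rs ((localCohomology I d).obj M) (M ⧸ (Ideal.ofList rs • ⊤ : Submodule R M)) := by
  subst hl
  obtain ⟨ι, hι⟩ := exists_isExtUnion M rfl hrs hM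
  exact hι.coregTo rs hrs M _ hM (Submodule.smul_mono_left hs)

end

section
universe u
open CategoryTheory TensorProduct

open Pointwise
variable {R : Type u} [CommRing R]
variable {H H' K M M' X X' Q C I Y : Type u} [AddCommGroup H] [Module R H] [AddCommGroup H']
  [Module R H'] [AddCommGroup K] [Module R K] [AddCommGroup M] [Module R M] [AddCommGroup M']
  [Module R M'] [AddCommGroup X] [Module R X] [AddCommGroup X'] [Module R X'] [AddCommGroup Q]
  [Module R Q] [AddCommGroup C] [Module R C] [AddCommGroup I] [Module R I] [AddCommGroup Y]
  [Module R Y]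

/-- A linear map restricted to the submodules killed by `x`. -/
def torsionByMap (x : R) (f : H →ₗ[R] H') :
    Submodule.torsionBy R H x →ₗ[R] Submodule.torsionBy R H' x :=
  f.restrict fun y hy => by
    rw [Submodule.mem_torsionBy_iff] at hy ⊢
    rw [← map_smul, hy, map_zero]

/-- An equivalence restricted to the submodules killed by `x`. -/
def torsionByCongr (x : R) (e : H ≃ₗ[R] H') :
    Submodule.torsionBy R H x ≃ₗ[R] Submodule.torsionBy R H' x :=
  LinearEquiv.ofLinearMap (torsionByMap x e.toLinearMap) (torsionByMap x e.symm.toLinearMap)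
    (LinearMap.ext fun y => Subtype.ext (e.apply_symm_apply y.1))
    (LinearMap.ext fun y => Subtype.ext (e.symm_apply_apply y.1))

lemma CoregTo.congr {rs : List R} (h : CoregTo rs H K) (e : H ≃ₗ[R] H') : CoregTo rs H' K := by
  induction rs generalizing H H' with
  | nil => exact h.map fun e' => e.symm ≪≫ₗ e'
  | cons x rs ih =>
    refine ⟨fun y => ?_, ih h.2 (torsionByCongr x e)⟩
    obtain ⟨z, hz⟩ := h.1 (e.symm y)
    exact ⟨e z, by rw [← map_smul, hz, e.apply_symm_apply]⟩

lemma CoregTo.subsingleton {rs : List R} (h : CoregTo rs H K) [Subsingleton H] :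
    Subsingleton K := by
  induction rs generalizing H with
  | nil => exact h.elim fun e => e.symm.toEquiv.subsingleton
  | cons x rs ih => exact ih h.2

lemma coregTo_hom (hI : Module.Injective R I) (rs : List R)
    (hC : RingTheory.Sequence.IsWeaklyRegular C rs) :
    CoregTo rs (C →ₗ[R] I) ((C ⧸ (Ideal.ofList rs • ⊤ : Submodule R C)) →ₗ[R] I) := by
  induction rs generalizing C with
  | nil =>
    have hbot : (Ideal.ofList ([] : List R) • ⊤ : Submodule R C) = ⊥ := by simp
    exact ⟨(Submodule.quotEquivOfEqBot _ hbot).symm.congrLeft I R⟩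
  | cons x rs ih =>
    rw [RingTheory.Sequence.isWeaklyRegular_cons_iff] at hC
    refine ⟨fun h => ?_, ?_⟩
    · obtain ⟨z, hz⟩ := hI.out (x • (LinearMap.id : C →ₗ[R] C)) (ExtMod.smul_injective hC.1) h
      exact ⟨z, LinearMap.ext fun c => by simpa using hz c⟩
    · let φ : (QuotSMulTop x C →ₗ[R] I) →ₗ[R] Submodule.torsionBy R (C →ₗ[R] I) x :=
        (LinearMap.lcomp R I (Submodule.mkQ (x • ⊤))).codRestrict _ fun g => by
          rw [Submodule.mem_torsionBy_iff]
          refine LinearMap.ext fun c => ?_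
          have h0 : (x • (⊤ : Submodule R C)).mkQ (x • c) = 0 :=
            (Submodule.Quotient.mk_eq_zero _).2 ⟨c, trivial, rfl⟩
          exact ((g.map_smul x _).symm.trans (congrArg g ((map_smul _ x c).symm.trans h0))).trans
            (map_zero g)
      have hφ : Function.Bijective φ := by
        constructor
        · intro g g' h
          exact Submodule.linearMap_qext _ (congrArg Subtype.val h)
        · rintro ⟨f, hf⟩
          rw [Submodule.mem_torsionBy_iff] at hf
          have hle : x • (⊤ : Submodule R C) ≤ LinearMap.ker f := by
            rintro _ ⟨c, -, rfl⟩
            exact (map_smul f x c).trans (LinearMap.congr_fun hf c)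
          exact ⟨Submodule.liftQ _ f hle, Subtype.ext (Submodule.liftQ_mkQ _ f hle)⟩
      exact ((ih hC.2).congr (LinearEquiv.ofBijective φ hφ)).trans_equiv
        ((Submodule.quotOfListConsSMulTopEquivQuotSMulTopInner C x rs).symm.congrLeft I R)

lemma CoregTo.exists_exact {rs : List R} {f : M →ₗ[R] X} {g : X →ₗ[R] Q}
    (hf : Function.Injective f) (hex : Function.Exact f g) (hg : Function.Surjective g)
    (hM : CoregTo rs M M') (hX : CoregTo rs X X') :
    ∃ (Q' : Type u) (_ : AddCommGroup Q') (_ : Module R Q') (f' : M' →ₗ[R] X') (g' : X' →ₗ[R] Q'),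
      Function.Injective f' ∧ Function.Exact f' g' ∧ Function.Surjective g' ∧ CoregTo rs Q Q' := by
  induction rs generalizing M X Q with
  | nil =>
    obtain ⟨e⟩ := hM
    obtain ⟨e'⟩ := hX
    refine ⟨Q, inferInstance, inferInstance, e'.toLinearMap ∘ₗ f ∘ₗ e.symm.toLinearMap,
      g ∘ₗ e'.symm.toLinearMap, e'.injective.comp (hf.comp e.symm.injective), fun y => ?_,
      hg.comp e'.symm.surjective, ⟨LinearEquiv.refl R Q⟩⟩
    refine (hex (e'.symm y)).trans ⟨?_, ?_⟩
    · rintro ⟨z, hz⟩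
      exact ⟨e z, by simp [hz]⟩
    · rintro ⟨z, rfl⟩
      exact ⟨e.symm z, by simp⟩
  | cons x rs ih =>
    have hf' : Function.Injective (torsionByMap x f) :=
      fun y z h => Subtype.ext (hf (congrArg Subtype.val h))
    have hex' : Function.Exact (torsionByMap x f) (torsionByMap x g) := by
      intro y
      constructor
      · intro h
        obtain ⟨m, hm⟩ := (hex y.1).1 (congrArg Subtype.val h)
        have hy : x • y.1 = 0 := y.2
        refine ⟨⟨m, (Submodule.mem_torsionBy_iff _ _).2 (hf ?_)⟩, Subtype.ext hm⟩
        rw [map_smul, hm, map_zero, hy]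
      · rintro ⟨m, rfl⟩
        exact Subtype.ext (hex.apply_apply_eq_zero m.1)
    have hg' : Function.Surjective (torsionByMap x g) := by
      intro q
      obtain ⟨z, hz⟩ := hg q.1
      have hq : x • q.1 = 0 := q.2
      obtain ⟨m, hm⟩ := (hex (x • z)).1 (by rw [map_smul, hz, hq])
      obtain ⟨m', rfl⟩ := hM.1 m
      refine ⟨⟨z - f m', (Submodule.mem_torsionBy_iff _ _).2 ?_⟩, Subtype.ext ?_⟩
      · rw [smul_sub, ← hm, map_smul, sub_self]
      · exact (map_sub g _ _).trans (by rw [hex.apply_apply_eq_zero, sub_zero, hz])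
    obtain ⟨Q', i1, i2, f', g', h1, h2, h3, h4⟩ := ih hf' hex' hg' hM.2 hX.2
    refine ⟨Q', i1, i2, f', g', h1, h2, h3, fun q => ?_, h4⟩
    obtain ⟨y, rfl⟩ := hg q
    obtain ⟨z, rfl⟩ := hX.1 y
    exact ⟨g z, (map_smul _ _ _).symm⟩

lemma CoregTo.exists_extension {rs : List R} (h : CoregTo rs H K)
    (hX : ∀ r ∈ rs, ∀ y : X, r • y = 0) {i : X →ₗ[R] Y}
    (hK : ∀ f : X →ₗ[R] K, ∃ f' : Y →ₗ[R] K, f' ∘ₗ i = f) (f : X →ₗ[R] H) :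
    ∃ f' : Y →ₗ[R] H, f' ∘ₗ i = f := by
  induction rs generalizing H with
  | nil =>
    obtain ⟨e⟩ := h
    obtain ⟨f', hf'⟩ := hK (e.toLinearMap ∘ₗ f)
    refine ⟨e.symm.toLinearMap ∘ₗ f', ?_⟩
    rw [LinearMap.comp_assoc, hf']
    exact LinearMap.ext fun y => e.symm_apply_apply _
  | cons x rs ih =>
    obtain ⟨f', hf'⟩ := ih h.2 (fun r hr => hX r (by simp [hr]))
      (f.codRestrict (Submodule.torsionBy R H x) fun y => by
        rw [Submodule.mem_torsionBy_iff, ← map_smul, hX x (by simp), map_zero])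
    refine ⟨Submodule.subtype _ ∘ₗ f', ?_⟩
    rw [LinearMap.comp_assoc, hf', LinearMap.subtype_comp_codRestrict]

end

section
universe u
open CategoryTheory TensorProduct

section
variable {R : Type u} [CommRing R]

lemma LinearMap.exists_comp_eq_of_ker_le {A B D : Type*} [AddCommGroup A] [Module R A]
    [AddCommGroup B] [Module R B] [AddCommGroup D] [Module R D] {p : A →ₗ[R] B}
    (hp : Function.Surjective p) (q : A →ₗ[R] D) (h : LinearMap.ker p ≤ LinearMap.ker q) :
    ∃ g : B →ₗ[R] D, g ∘ₗ p = q := by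
  refine ⟨(LinearMap.ker p).liftQ q h ∘ₗ (p.quotKerEquivOfSurjective hp).symm.toLinearMap,
    LinearMap.ext fun a => ?_⟩
  have h1 : (p.quotKerEquivOfSurjective hp).symm (p a) = (LinearMap.ker p).mkQ a := by
    rw [LinearEquiv.symm_apply_eq]
    rfl
  simp [h1]

/-- `K` behaves like an injective `R ⧸ J`-module with respect to finitely generated modules
killed by `J`. -/
def InjectiveModulo (J : Ideal R) (K : Type u) [AddCommGroup K] [Module R K] : Prop :=
  ∀ (F Y : Type u) [AddCommGroup F] [AddCommGroup Y] [Module R F] [Module R Y]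
    [Module.Finite R Y], (∀ r ∈ J, ∀ y : Y, r • y = 0) → ∀ (p : F →ₗ[R] Y) (q : F →ₗ[R] K),
    LinearMap.ker p ≤ LinearMap.ker q → ∃ f : Y →ₗ[R] K, f ∘ₗ p = q

namespace InjectiveModulo
variable {J : Ideal R} {K K' : Type u} [AddCommGroup K] [Module R K] [AddCommGroup K'] [Module R K']

lemma of_extension
    (h : ∀ (F Y : Type u) [AddCommGroup F] [AddCommGroup Y] [Module R F] [Module R Y]
      [Module.Finite R Y], (∀ r ∈ J, ∀ y : Y, r • y = 0) → ∀ (p : F →ₗ[R] Y) (q : F →ₗ[R] K),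
      Function.Injective p → ∃ f : Y →ₗ[R] K, f ∘ₗ p = q) : InjectiveModulo J K := by
  intro F Y _ _ _ _ _ hY p q hpq
  obtain ⟨f, hf⟩ := h (F ⧸ LinearMap.ker p) Y hY ((LinearMap.ker p).liftQ p le_rfl)
    ((LinearMap.ker p).liftQ q hpq)
    (LinearMap.ker_eq_bot.1 (Submodule.ker_liftQ_eq_bot _ _ _ le_rfl))
  refine ⟨f, ?_⟩
  rw [← Submodule.liftQ_mkQ (LinearMap.ker p) q hpq, ← hf, LinearMap.comp_assoc,
    Submodule.liftQ_mkQ]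

lemma of_equiv (h : InjectiveModulo J K) (e : K ≃ₗ[R] K') : InjectiveModulo J K' := by
  intro F Y _ _ _ _ _ hY p q hpq
  obtain ⟨f, hf⟩ := h F Y hY p (e.symm.toLinearMap ∘ₗ q) fun y hy => by
    have := hpq hy
    simp_all
  refine ⟨e.toLinearMap ∘ₗ f, ?_⟩
  rw [LinearMap.comp_assoc, hf]
  ext y
  simp

lemma of_subsingleton [Subsingleton K] : InjectiveModulo J K :=
  fun _ _ _ _ _ _ _ _ _ _ _ => ⟨0, LinearMap.ext fun _ => Subsingleton.elim _ _⟩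

lemma torsionBySet {I : Type u} [AddCommGroup I] [Module R I] (hI : Module.Injective R I) :
    InjectiveModulo J (Submodule.torsionBySet R I J) := by
  refine of_extension fun F Y _ _ _ _ _ hY p q hp => ?_
  obtain ⟨f, hf⟩ := hI.out p hp (Submodule.subtype _ ∘ₗ q)
  refine ⟨f.codRestrict _ fun y => ?_, LinearMap.ext fun y => Subtype.ext (hf y)⟩
  rw [Submodule.mem_torsionBySet_iff]
  rintro ⟨r, hr⟩
  exact (map_smul f r y).symm.trans (by rw [hY r hr, map_zero])

lemma exists_apply_eq (h : InjectiveModulo J K) {Y : Type u} [AddCommGroup Y] [Module R Y]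
    [Module.Finite R Y] (hY : ∀ r ∈ J, ∀ y : Y, r • y = 0) (y : Y) (z : K)
    (hyz : ∀ r : R, r • y = 0 → r • z = 0) : ∃ f : Y →ₗ[R] K, f y = z := by
  obtain ⟨f, hf⟩ := h R Y hY (LinearMap.toSpanSingleton R Y y) (LinearMap.toSpanSingleton R K z)
    fun r hr => by simpa using hyz r (by simpa using hr)
  exact ⟨f, by simpa using LinearMap.congr_fun hf 1⟩

end InjectiveModulo

section local_ring
variable [IsLocalRing R]

open IsLocalRing in
lemma exists_not_mem_forall_mul_mem {Y : Type u} [AddCommGroup Y] [Module R Y] {s : ℕ}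
    {N : Submodule R Y} (hN : N ≠ ⊤) (hs : ∀ r ∈ maximalIdeal R ^ s, ∀ y : Y, r • y ∈ N) :
    ∃ y : Y, y ∉ N ∧ ∀ r ∈ maximalIdeal R, r • y ∈ N := by
  induction s with
  | zero => exact absurd (eq_top_iff.2 fun y _ => by simpa using hs 1 (by simp) y) hN
  | succ s ih =>
    by_cases h : ∀ r ∈ maximalIdeal R ^ s, ∀ y : Y, r • y ∈ N
    · exact ih h
    · push Not at h
      obtain ⟨r, hr, y, hy⟩ := h
      refine ⟨r • y, hy, fun t ht => ?_⟩
      rw [smul_smul]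
      exact hs _ (by rw [pow_succ']; exact Ideal.mul_mem_mul ht hr) y

open IsLocalRing in
lemma InjectiveModulo.ker [IsNoetherianRing R] {J : Ideal R} {s : ℕ} (hs : maximalIdeal R ^ s ≤ J)
    (hJ : J ≠ ⊤) {K K' : Type u} [AddCommGroup K] [Module R K] [AddCommGroup K'] [Module R K']
    (hK : InjectiveModulo J K) (hK' : InjectiveModulo J K') (hJK : ∀ r ∈ J, ∀ y : K, r • y = 0)
    (g : K →ₗ[R] K') (hg : Function.Surjective g) : InjectiveModulo J (LinearMap.ker g) := by
  have unit_of {r : R} (hr : r ∉ maximalIdeal R) : ∃ t, t * r = 1 := by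
    rw [mem_maximalIdeal, mem_nonunits_iff, not_not] at hr
    exact ⟨_, hr.val_inv_mul⟩
  have socle (z : K') (hz : ∀ r ∈ maximalIdeal R, r • z = 0) :
      ∃ w : K, (∀ r ∈ maximalIdeal R, r • w = 0) ∧ g w = z := by
    obtain ⟨t, ht, htJ⟩ := exists_not_mem_forall_mul_mem (s := s) (N := (J : Submodule R R)) hJ
      fun r hr y => J.mul_mem_right y (hs hr)
    obtain ⟨f, hf⟩ := hK'.exists_apply_eq (Y := R ⧸ J) (fun r hr y => by
      obtain ⟨y, rfl⟩ := Ideal.Quotient.mk_surjective y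
      exact Ideal.Quotient.eq_zero_iff_mem.2 (J.mul_mem_right y hr)) (Ideal.Quotient.mk J t) z
      fun r hr => by
        by_contra h
        obtain ⟨r', hr'⟩ := unit_of fun hm => h (hz r hm)
        have : r * t ∈ J := Ideal.Quotient.eq_zero_iff_mem.1 hr
        apply ht
        have h2 := J.mul_mem_left r' this
        rwa [← mul_assoc, hr', one_mul] at h2
    obtain ⟨w, hw⟩ := hg (f (Ideal.Quotient.mk J 1))
    refine ⟨t • w, fun r hr => ?_, ?_⟩
    · rw [smul_smul]
      exact hJK _ (htJ r hr) w
    · rw [map_smul, hw, ← map_smul, ← hf]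
      congr 1
      exact (congrArg (Ideal.Quotient.mk J) (mul_one t))
  intro F Y _ _ _ _ _ hY p q hpq
  let S : Set (Submodule R Y) := {N | LinearMap.range p ≤ N ∧ ∃ φ : Y →ₗ[R] K,
    φ ∘ₗ p = Submodule.subtype _ ∘ₗ q ∧ ∀ y ∈ N, g (φ y) = 0}
  have hS : S.Nonempty := by
    obtain ⟨φ, hφ⟩ := hK F Y hY p (Submodule.subtype _ ∘ₗ q) fun y hy => by
      have := hpq hy
      simp_all
    refine ⟨LinearMap.range p, le_rfl, φ, hφ, ?_⟩
    rintro _ ⟨y, rfl⟩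
    rw [← LinearMap.comp_apply φ, hφ]
    exact (q y).2
  obtain ⟨N, ⟨hpN, φ, hφ, hN⟩, hmax⟩ := set_has_maximal_iff_noetherian.2
    (inferInstance : IsNoetherian R Y) S hS
  by_cases htop : N = ⊤
  · refine ⟨φ.codRestrict _ fun y => hN y (htop ▸ trivial), LinearMap.ext fun y => Subtype.ext ?_⟩
    exact LinearMap.congr_fun hφ y
  exfalso
  obtain ⟨y, hy, hmy⟩ := exists_not_mem_forall_mul_mem htop (s := s)
    fun r hr y => by rw [hY r (hs hr)]; exact N.zero_mem
  obtain ⟨w, hw, hgw⟩ := socle (g (φ y)) fun r hr => by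
    rw [← map_smul, ← map_smul]
    exact hN _ (hmy r hr)
  obtain ⟨ψ, hψ⟩ := hK.exists_apply_eq (Y := Y ⧸ N) (fun r hr y => by
      obtain ⟨y, rfl⟩ := Submodule.mkQ_surjective _ y
      rw [← map_smul, hY r hr, map_zero]) (N.mkQ y) w fun r hr => by
        by_contra h
        obtain ⟨r', hr'⟩ := unit_of fun hm => h (hw r hm)
        rw [← map_smul] at hr
        have h2 := N.smul_mem r' ((Submodule.Quotient.mk_eq_zero _).1 hr)
        rw [smul_smul, hr', one_smul] at h2
        exact hy h2
  have hmk {y : Y} (hy : y ∈ N) : N.mkQ y = 0 := (Submodule.Quotient.mk_eq_zero _).2 hy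
  refine hmax (N ⊔ Submodule.span R {y}) ⟨hpN.trans le_sup_left, φ - ψ ∘ₗ N.mkQ, ?_, ?_⟩ ?_
  · rw [LinearMap.sub_comp, hφ]
    ext z
    simp [hmk (hpN ⟨z, rfl⟩), -Submodule.mkQ_apply]
  · intro v hvy
    obtain ⟨v, hv, v', hv', rfl⟩ := Submodule.mem_sup.1 hvy
    obtain ⟨r, rfl⟩ := Submodule.mem_span_singleton.1 hv'
    simp [hmk hv, hN v hv, hψ, hgw, -Submodule.mkQ_apply]
  · refine lt_of_le_of_ne le_sup_left fun h => hy ?_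
    rw [h]
    exact Submodule.mem_sup_right (Submodule.mem_span_singleton_self y)
end local_ring

section Evaluation
variable {J : Ideal R} {C K K' : Type u} [AddCommGroup C] [Module R C] [AddCommGroup K] [Module R K]
  [AddCommGroup K'] [Module R K'] {n : ℕ} {c : Fin n → C}

lemma InjectiveModulo.exists_sum_eq [Module.Finite R C] (hK : InjectiveModulo J K)
    (hJK : ∀ r ∈ J, ∀ y : K, r • y = 0) (hJC : ∀ r ∈ J, ∀ y : C, r • y = 0)
    (hann : ∀ r : R, (∀ y : C, r • y = 0) → r ∈ J) (hc : Submodule.span R (Set.range c) = ⊤)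
    (z : K) : ∃ f : Fin n → C →ₗ[R] K, ∑ i, f i (c i) = z := by
  obtain ⟨f, hf⟩ := hK.exists_apply_eq (Y := Fin n → C)
    (fun r hr y => funext fun i => hJC r hr (y i)) c z fun r hr => by
      refine hJK r (hann r fun y => ?_) z
      have hy : y ∈ Submodule.span R (Set.range c) := hc ▸ trivial
      have hle : Submodule.span R (Set.range c) ≤ LinearMap.ker (LinearMap.lsmul R C r) := by
        rw [Submodule.span_le]
        rintro _ ⟨i, rfl⟩
        exact congrFun hr i
      exact hle hy
  refine ⟨fun i => f ∘ₗ LinearMap.single R (fun _ => C) i, ?_⟩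
  rw [← hf]
  conv_rhs => rw [← Finset.univ_sum_single c]
  simp

lemma InjectiveModulo.exists_relations [IsNoetherianRing R] [Module.Finite R C]
    (hK : InjectiveModulo J K)
    (hJC : ∀ r ∈ J, ∀ y : C, r • y = 0) (hend : ∀ e : C →ₗ[R] C, ∃ r : R, ∀ y, e y = r • y)
    (hc : Submodule.span R (Set.range c) = ⊤) (f : Fin n → C →ₗ[R] K)
    (hf : ∑ i, f i (c i) = 0) :
    ∃ (k : ℕ) (a : Fin k → Fin n → R) (g : Fin k → C →ₗ[R] K),
      (∀ j, ∑ i, a j i • c i = 0) ∧ ∀ i, f i = ∑ j, a j i • g j := by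
  have hsurj : Function.Surjective (Fintype.linearCombination R c) := by
    rw [← LinearMap.range_eq_top, Fintype.range_linearCombination, hc]
  obtain ⟨k, a, ha⟩ := Submodule.fg_iff_exists_fin_generating_family.1
    (IsNoetherian.noetherian (LinearMap.ker (Fintype.linearCombination R c)))
  let p : (Fin n → C) →ₗ[R] (Fin k → C) :=
    LinearMap.pi fun j => ∑ i, a j i • LinearMap.proj i
  let q : (Fin n → C) →ₗ[R] K := ∑ i, f i ∘ₗ LinearMap.proj i
  obtain ⟨g, hg⟩ := hK (Fin n → C) (Fin k → C)
    (fun r hr y => funext fun i => hJC r hr (y i)) p q fun x hx => by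
      obtain ⟨e, he⟩ := LinearMap.exists_comp_eq_of_ker_le hsurj (Fintype.linearCombination R x)
        (by
          rw [← ha, Submodule.span_le]
          rintro _ ⟨j, rfl⟩
          simpa [p, Fintype.linearCombination_apply] using congrFun (show p x = 0 from hx) j)
      obtain ⟨r, hr⟩ := hend e
      have hx (i : Fin n) : x i = r • c i := by
        rw [← hr]
        simpa [Fintype.linearCombination_apply, Pi.single_apply] using
          (LinearMap.congr_fun he (Pi.single i 1)).symm
      simp [q, hx, ← Finset.smul_sum, hf]
  refine ⟨k, a, fun j => g ∘ₗ LinearMap.single R (fun _ => C) j, fun j => ?_, fun i => ?_⟩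
  · have : a j ∈ LinearMap.ker (Fintype.linearCombination R c) :=
      ha ▸ Submodule.subset_span ⟨j, rfl⟩
    simpa [Fintype.linearCombination_apply] using this
  · refine LinearMap.ext fun x => ?_
    have h1 : q (Pi.single i x) = f i x := by
      have (j : Fin n) : f j (Pi.single (M := fun _ => C) i x j) = if j = i then f i x else 0 := by
        split_ifs with h
        · subst h; simp
        · simp [h]
      simp [q, this]
    have h2 : p (Pi.single i x) = ∑ j, Pi.single j (a j i • x) := by
      rw [Finset.univ_sum_single]
      funext j
      have (l : Fin n) : a j l • (Pi.single (M := fun _ => C) i x l) =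
          if l = i then a j i • x else 0 := by
        split_ifs with h
        · subst h; simp
        · simp [h]
      simp [p, this]
    rw [← h1, ← hg, LinearMap.comp_apply, h2, map_sum]
    simp only [LinearMap.coe_sum, Finset.sum_apply, LinearMap.smul_apply, LinearMap.comp_apply,
      LinearMap.single_apply]
    refine Finset.sum_congr rfl fun j _ => ?_
    rw [Pi.single_smul, map_smul]

lemma InjectiveModulo.exists_eq_comp [IsNoetherianRing R] [Module.Finite R C]
    (hK : InjectiveModulo J K) (hJK : ∀ r ∈ J, ∀ y : K, r • y = 0)
    (hJC : ∀ r ∈ J, ∀ y : C, r • y = 0) (hann : ∀ r : R, (∀ y : C, r • y = 0) → r ∈ J)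
    (hend : ∀ e : C →ₗ[R] C, ∃ r : R, ∀ y, e y = r • y)
    (Φ : (C →ₗ[R] K) →ₗ[R] (C →ₗ[R] K')) : ∃ g : K →ₗ[R] K', ∀ f, Φ f = g ∘ₗ f := by
  obtain ⟨n, c, hc⟩ := Module.Finite.exists_fin (R := R) (M := C)
  let p : (Fin n → C →ₗ[R] K) →ₗ[R] K := ∑ i, LinearMap.applyₗ (c i) ∘ₗ LinearMap.proj i
  let q : (Fin n → C →ₗ[R] K) →ₗ[R] K' :=
    ∑ i, LinearMap.applyₗ (c i) ∘ₗ Φ ∘ₗ LinearMap.proj i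
  have hp (f) : p f = ∑ i, f i (c i) := by simp [p]
  have hq (f) : q f = ∑ i, Φ (f i) (c i) := by simp [q]
  obtain ⟨g, hg⟩ := LinearMap.exists_comp_eq_of_ker_le (p := p) (fun z => by
    obtain ⟨f, hf⟩ := hK.exists_sum_eq hJK hJC hann hc z
    exact ⟨f, (hp f).trans hf⟩) q fun f hf => by
      obtain ⟨k, a, g, ha, hg⟩ := hK.exists_relations hJC hend hc f ((hp f).symm.trans hf)
      rw [LinearMap.mem_ker, hq]
      simp only [hg, map_sum, map_smul, LinearMap.coe_sum, Finset.sum_apply, LinearMap.smul_apply]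
      rw [Finset.sum_comm]
      refine Finset.sum_eq_zero fun j _ => ?_
      simp only [← map_smul]
      rw [← map_sum, ha, map_zero]
  refine ⟨g, fun f => LinearMap.ext_on_range hc fun i => ?_⟩
  have h1 := LinearMap.congr_fun hg (Pi.single i f)
  have h2 (j : Fin n) : (Pi.single (M := fun _ => C →ₗ[R] K) i f j) (c j) =
      if j = i then f (c i) else 0 := by
    split_ifs with h
    · subst h; simp
    · simp [h]
  have h3 (j : Fin n) : Φ (Pi.single (M := fun _ => C →ₗ[R] K) i f j) (c j) =
      if j = i then Φ f (c i) else 0 := by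
    split_ifs with h
    · subst h; simp
    · simp [h]
  rw [LinearMap.comp_apply, hp, hq] at h1
  simpa [h2, h3] using h1.symm
end Evaluation
end

end

section
universe u
open CategoryTheory TensorProduct

variable {R : Type u} [CommRing R]

lemma CoregTo.nonempty_equiv {rs : List R} {H K K' : Type u} [AddCommGroup H] [Module R H]
    [AddCommGroup K] [Module R K] [AddCommGroup K'] [Module R K'] (h : CoregTo rs H K)
    (h' : CoregTo rs H K') : Nonempty (K ≃ₗ[R] K') := by
  induction rs generalizing H with
  | nil => exact h.elim fun e => h'.map fun e' => e.symm ≪≫ₗ e'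
  | cons x rs ih => exact ih h.2 h'.2

lemma nonempty_equiv_hom_submodule {C K M : Type*} [AddCommGroup C] [Module R C] [AddCommGroup K]
    [Module R K] [AddCommGroup M] [Module R M] (N : Submodule R K) (f : M →ₗ[R] C →ₗ[R] K)
    (hf : Function.Injective f) (hN : ∀ h : C →ₗ[R] K, (∃ m, f m = h) ↔ ∀ c, h c ∈ N) :
    Nonempty (M ≃ₗ[R] (C →ₗ[R] N)) := by
  let g : M →ₗ[R] C →ₗ[R] N :=
    { toFun := fun m => (f m).codRestrict N ((hN _).1 ⟨m, rfl⟩)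
      map_add' := fun a b => LinearMap.ext fun c => Subtype.ext (by simp)
      map_smul' := fun a b => LinearMap.ext fun c => Subtype.ext (by simp) }
  refine ⟨LinearEquiv.ofBijective g ⟨fun a b h => hf (LinearMap.ext fun c => ?_), fun h => ?_⟩⟩
  · exact congrArg Subtype.val (LinearMap.congr_fun h c)
  · obtain ⟨m, hm⟩ := (hN (N.subtype ∘ₗ h)).2 fun c => (h c).2
    exact ⟨m, LinearMap.ext fun c => Subtype.ext (LinearMap.congr_fun hm c)⟩

open IsLocalRing in
lemma exists_injectiveModulo_equiv_hom [IsNoetherianRing R] [IsLocalRing R] {s : ℕ} (rs : List R)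
    (hs : maximalIdeal R ^ s ≤ Ideal.ofList rs) (hJ : Ideal.ofList rs ≠ ⊤) (C : ModuleCat.{u} R)
    [Module.Finite R C] (hC : RingTheory.Sequence.IsWeaklyRegular C rs)
    (hann : ∀ r : R, (∀ y : C ⧸ (Ideal.ofList rs • ⊤ : Submodule R C), r • y = 0) →
      r ∈ Ideal.ofList rs)
    (hend : ∀ e : (C ⧸ (Ideal.ofList rs • ⊤ : Submodule R C)) →ₗ[R]
      (C ⧸ (Ideal.ofList rs • ⊤ : Submodule R C)), ∃ r : R, ∀ y, e y = r • y)
    (n : ℕ) (M : ModuleCat.{u} R) (M' : Type u) [AddCommGroup M'] [Module R M']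
    (hM : CoregTo rs M M') (h : HasCoresDimLE R (IsCInjective R C) n M) :
    ∃ (K : Type u) (_ : AddCommGroup K) (_ : Module R K), InjectiveModulo (Ideal.ofList rs) K ∧
      (∀ r ∈ Ideal.ofList rs, ∀ y : K, r • y = 0) ∧
      Nonempty (M' ≃ₗ[R] ((C ⧸ (Ideal.ofList rs • ⊤ : Submodule R C)) →ₗ[R] K)) := by
  set J := Ideal.ofList rs
  have hJC : ∀ r ∈ J, ∀ y : C ⧸ (J • ⊤ : Submodule R C), r • y = 0 := by
    intro r hr y
    obtain ⟨y, rfl⟩ := Submodule.mkQ_surjective _ y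
    exact (Submodule.Quotient.mk_eq_zero _).2 (Submodule.smul_mem_smul hr trivial)
  have of_subsingleton (M M' : Type u) [AddCommGroup M] [Module R M] [AddCommGroup M']
      [Module R M'] (hM : CoregTo rs M M') (h : Subsingleton M) :
      ∃ (K : Type u) (_ : AddCommGroup K) (_ : Module R K), InjectiveModulo J K ∧
        (∀ r ∈ J, ∀ y : K, r • y = 0) ∧
        Nonempty (M' ≃ₗ[R] ((C ⧸ (J • ⊤ : Submodule R C)) →ₗ[R] K)) := by
    have := hM.subsingleton
    exact ⟨PUnit, inferInstance, inferInstance, .of_subsingleton,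
      fun _ _ _ => Subsingleton.elim _ _, ⟨LinearEquiv.ofSubsingleton _ _⟩⟩
  have of_injective (M M' : Type u) [AddCommGroup M] [Module R M] [AddCommGroup M']
      [Module R M'] (hM : CoregTo rs M M')
      (h : ∃ I : ModuleCat.{u} R, Module.Injective R I ∧ Nonempty (M ≃ₗ[R] (C →ₗ[R] I))) :
      ∃ (K : Type u) (_ : AddCommGroup K) (_ : Module R K), InjectiveModulo J K ∧
        (∀ r ∈ J, ∀ y : K, r • y = 0) ∧
        Nonempty (M' ≃ₗ[R] ((C ⧸ (J • ⊤ : Submodule R C)) →ₗ[R] K)) := by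
    obtain ⟨I, hI, ⟨e⟩⟩ := h
    obtain ⟨e'⟩ := (hM.congr e).nonempty_equiv (coregTo_hom hI rs hC)
    obtain ⟨e''⟩ := nonempty_equiv_hom_submodule (Submodule.torsionBySet R I J)
      (LinearMap.id (M := (C ⧸ (J • ⊤ : Submodule R C)) →ₗ[R] I)) Function.injective_id
      fun h => ⟨fun _ c => (Submodule.mem_torsionBySet_iff _ _).2 fun r => by
        exact (map_smul h r.1 c).symm.trans (by rw [hJC r.1 r.2, map_zero]), fun _ => ⟨h, rfl⟩⟩
    exact ⟨_, inferInstance, inferInstance, .torsionBySet hI, fun r hr y => Subtype.ext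
      ((Submodule.mem_torsionBySet_iff _ _).1 y.2 ⟨r, hr⟩), ⟨e' ≪≫ₗ e''⟩⟩
  induction n generalizing M M' with
  | zero => exact h.elim (of_subsingleton M M' hM) (of_injective M M' hM)
  | succ n ih =>
    rcases h with h | ⟨X, f, hX, hf, h⟩
    · exact of_subsingleton M M' hM h
    have hX' := hX
    obtain ⟨I, hI, ⟨e⟩⟩ := hX'
    obtain ⟨Q', _, _, f', g', hf', hex', hg', hQ⟩ := hM.exists_exact hf
      (LinearMap.exact_map_mkQ_range f) (Submodule.mkQ_surjective _)
      ((coregTo_hom hI rs hC).congr e.symm)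
    obtain ⟨K, _, _, hK, hJK, ⟨eK⟩⟩ := of_injective X _ ((coregTo_hom hI rs hC).congr e.symm) hX
    obtain ⟨K', _, _, hK', hJK', ⟨eK'⟩⟩ := ih _ _ hQ h
    obtain ⟨g, hg⟩ := hK.exists_eq_comp hJK hJC hann hend
      (eK'.toLinearMap ∘ₗ g' ∘ₗ eK.symm.toLinearMap)
    have hgs : Function.Surjective g := by
      intro z
      obtain ⟨n, c, hc⟩ := Module.Finite.exists_fin (R := R) (M := C ⧸ (J • ⊤ : Submodule R C))
      obtain ⟨k, rfl⟩ := hK'.exists_sum_eq hJK' hJC hann hc z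
      have hl (i : Fin n) : ∃ l, g ∘ₗ l = k i := by
        obtain ⟨y, hy⟩ := hg' (eK'.symm (k i))
        refine ⟨eK y, ?_⟩
        rw [← hg]
        simp [hy]
      choose l hl using hl
      exact ⟨∑ i, l i (c i), by simp [← hl]⟩
    obtain ⟨e'⟩ := nonempty_equiv_hom_submodule (LinearMap.ker g) (eK.toLinearMap ∘ₗ f')
      (eK.injective.comp hf') fun h => by
        have h1 : (∀ c, h c ∈ LinearMap.ker g) ↔ g ∘ₗ h = 0 := by
          simp [LinearMap.ext_iff]
        rw [h1, ← hg]
        have h2 := hex' (eK.symm h)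
        simp only [LinearMap.comp_apply, LinearEquiv.coe_coe, LinearEquiv.map_eq_zero_iff, h2,
          Set.mem_range, LinearEquiv.eq_symm_apply]
    exact ⟨_, inferInstance, inferInstance, hK.ker hs hJ hK' hJK g hgs,
      fun r hr y => Subtype.ext (hJK r hr y), ⟨e'⟩⟩

open IsLocalRing in
lemma exists_span_singleton_eq_top_of_equiv_hom [IsNoetherianRing R] [IsLocalRing R] {J : Ideal R}
    {C K : Type u} [AddCommGroup C] [Module R C] [Module.Finite R C] [AddCommGroup K] [Module R K]
    (hK : InjectiveModulo J K) (hJC : ∀ r ∈ J, ∀ y : C, r • y = 0)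
    (hend : ∀ e : C →ₗ[R] C, ∃ r : R, ∀ y, e y = r • y) (φ : C ≃ₗ[R] (C →ₗ[R] K)) :
    ∃ c : C, Submodule.span R {c} = ⊤ := by
  classical
  have hex : ∃ (n : ℕ) (c : Fin n → C), Submodule.span R (Set.range c) = ⊤ :=
    Module.Finite.exists_fin
  obtain ⟨n, hn, c, hc, hmin⟩ : ∃ n, n = Nat.find hex ∧ ∃ c : Fin n → C,
      Submodule.span R (Set.range c) = ⊤ ∧
      ∀ c' : Fin (n - 1) → C, n ≠ 0 → Submodule.span R (Set.range c') ≠ ⊤ := by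
    obtain ⟨c, hc⟩ := Nat.find_spec hex
    exact ⟨_, rfl, c, hc, fun c' hn h => Nat.find_min hex (m := Nat.find hex - 1) (by omega)
      ⟨c', h⟩⟩
  clear hn hex
  match n, c, hc, hmin with
  | 0, c, hc, _ => exact ⟨0, by rw [← hc]; simp⟩
  | 1, c, hc, _ => exact ⟨c 0, by rw [← hc]; congr 1; ext; simp [Fin.exists_fin_one, eq_comm]⟩
  | n + 2, c, hc, hmin =>
  exfalso
  have hmem (a : Fin (n + 2) → R) (ha : ∑ i, a i • c i = 0) (i : Fin (n + 2)) :
      a i ∈ maximalIdeal R := by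
    by_contra h
    rw [mem_maximalIdeal, mem_nonunits_iff, not_not] at h
    refine hmin (fun j => c (i.succAbove j)) (by omega) (top_le_iff.1 ?_)
    have hle (j) : c (i.succAbove j) ∈ Submodule.span R (Set.range fun j => c (i.succAbove j)) :=
      Submodule.subset_span ⟨j, rfl⟩
    rw [← hc, Submodule.span_le]
    rintro _ ⟨j, rfl⟩
    rcases eq_or_ne j i with rfl | hj
    · rw [Fin.sum_univ_succAbove _ j] at ha
      have h1 := eq_neg_of_add_eq_zero_left ha
      have h2 : c j = (h.unit⁻¹ : Rˣ) • a j • c j := by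
        rw [Units.smul_def, smul_smul, h.val_inv_mul, one_smul]
      rw [SetLike.mem_coe, h2, h1]
      exact Submodule.smul_of_tower_mem _ _ (neg_mem (Submodule.sum_mem _ fun j _ =>
        Submodule.smul_mem _ _ (hle j)))
    · obtain ⟨k, rfl⟩ := Fin.exists_succAbove_eq hj
      exact hle k
  obtain ⟨r, hr⟩ := hend (φ.symm.toLinearMap ∘ₗ φ.toLinearMap.flip)
  have hflip (x y : C) : φ x y = r • φ y x := by
    have h1 : φ.toLinearMap.flip y = φ (r • y) := by
      rw [← hr, LinearMap.comp_apply]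
      exact (φ.apply_symm_apply _).symm
    rw [map_smul] at h1
    exact LinearMap.congr_fun h1 x
  let f : Fin (n + 2) → C →ₗ[R] K := fun i =>
    if i = 0 then φ (c 1) else if i = 1 then -(r • φ (c 0)) else 0
  obtain ⟨k, a, g, ha, hg⟩ := hK.exists_relations hJC hend hc f (by
    have (i : Fin n) : f i.succ.succ = 0 := by
      simp [f, Fin.succ_ne_zero, Fin.succ_succ_ne_one]
    rw [Fin.sum_univ_succ, Fin.sum_univ_succ]
    simp [this, f, hflip (c 1)])
  have hspan (y : C) : ∃ b : Fin (n + 2) → R, ∑ i, b i • c i = y :=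
    (Submodule.mem_span_range_iff_exists_fun R).1 (hc ▸ trivial)
  choose b hb using fun j => hspan (φ.symm (g j))
  have h1 : c 1 = ∑ j, a j 0 • φ.symm (g j) := by
    apply φ.injective
    simpa [f] using hg 0
  have h2 := hmem (fun i => (if i = 1 then 1 else 0) - ∑ j, a j 0 * b j i) (by
    simp only [sub_smul, Finset.sum_sub_distrib, ite_smul, one_smul, zero_smul, Finset.sum_ite_eq',
      Finset.mem_univ, if_true, Finset.sum_smul]
    rw [Finset.sum_comm, sub_eq_zero]
    refine h1.trans (Finset.sum_congr rfl fun j _ => ?_)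
    rw [← hb, Finset.smul_sum]
    simp only [mul_smul]) 1
  rw [if_pos rfl] at h2
  have h3 : ∑ j, a j 0 * b j 1 ∈ maximalIdeal R :=
    sum_mem fun j _ => Ideal.mul_mem_right _ _ (hmem (a j) (ha j) 0)
  have h4 := add_mem h2 h3
  rw [sub_add_cancel] at h4
  exact (Ideal.ne_top_iff_one _).1 (maximalIdeal.isMaximal R).ne_top h4

end

section
universe u
open CategoryTheory TensorProduct

variable {R : Type u} [CommRing R]

lemma IsSemidualizing.annihilator_eq_bot {C : ModuleCat.{u} R} (hC : IsSemidualizing R C) :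
    Module.annihilator R C = ⊥ := by
  refine eq_bot_iff.2 fun r hr => hC.2.1.1 ?_
  rw [map_zero]
  exact LinearMap.ext fun c => Module.mem_annihilator.1 hr c

lemma IsSemidualizing.subsingleton_ext {C : ModuleCat.{u} R} (hC : IsSemidualizing R C) (i : ℕ) :
    Subsingleton (ExtMod R C C (i + 1)) :=
  have := hC.2.2 (i + 1) (by omega)
  (oldExtEquiv C (i + 1) C).symm.toEquiv.subsingleton

lemma IsSemidualizing.reduction [IsNoetherianRing R] {C : ModuleCat.{u} R}
    (hC : IsSemidualizing R C) (rs : List R) (hrs : RingTheory.Sequence.IsWeaklyRegular R rs) :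
    RingTheory.Sequence.IsWeaklyRegular C rs ∧
      (∀ r : R, (∀ y : C ⧸ (Ideal.ofList rs • ⊤ : Submodule R C), r • y = 0) →
        r ∈ Ideal.ofList rs) ∧
      ∀ e : (C ⧸ (Ideal.ofList rs • ⊤ : Submodule R C)) →ₗ[R]
        (C ⧸ (Ideal.ofList rs • ⊤ : Submodule R C)), ∃ r : R, ∀ y, e y = r • y := by
  have := hC.1
  obtain ⟨h1, h2, h3⟩ := isWeaklyRegular_of_bijective_hom C hC.annihilator_eq_bot rs R C
    (LinearMap.lsmul R C) hC.2.1 hC.subsingleton_ext hrs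
  refine ⟨h1, fun r hr => ?_, fun e => ?_⟩
  · have := h3 r fun c => (Submodule.Quotient.mk_eq_zero _).1 (hr (Submodule.Quotient.mk c))
    simpa using this
  · obtain ⟨r, hr⟩ := h2 (e ∘ₗ Submodule.mkQ _)
    refine ⟨r, fun y => ?_⟩
    obtain ⟨y, rfl⟩ := Submodule.mkQ_surjective _ y
    exact LinearMap.congr_fun hr y

open IsLocalRing in
lemma IsSemidualizing.nonempty_equiv_of_span_quotient [IsLocalRing R] {C : ModuleCat.{u} R}
    (hC : IsSemidualizing R C) {J : Ideal R} (hJ : J ≤ maximalIdeal R)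
    (h : ∃ c : C ⧸ (J • ⊤ : Submodule R C), Submodule.span R {c} = ⊤) : Nonempty (R ≃ₗ[R] C) := by
  obtain ⟨c, hc⟩ := h
  obtain ⟨c, rfl⟩ := Submodule.mkQ_surjective _ c
  have := hC.1
  have htop : (⊤ : Submodule R C) ≤ Submodule.span R {c} := by
    refine Submodule.le_of_le_smul_of_le_jacobson_bot (I := J) Module.Finite.fg_top
      (hJ.trans (maximalIdeal_le_jacobson _)) fun y _ => ?_
    have hy : Submodule.mkQ (J • ⊤ : Submodule R C) y ∈ Submodule.span R {Submodule.mkQ _ c} :=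
      hc ▸ trivial
    obtain ⟨r, hr⟩ := Submodule.mem_span_singleton.1 hy
    rw [← map_smul] at hr
    have := (Submodule.Quotient.eq _).1 hr.symm
    rw [← add_sub_cancel (r • c) y]
    exact Submodule.add_mem_sup (Submodule.smul_mem _ _ (Submodule.mem_span_singleton_self c)) this
  have hmem (y : C) : ∃ r : R, r • c = y := Submodule.mem_span_singleton.1 (htop trivial)
  refine ⟨LinearEquiv.ofBijective (LinearMap.toSpanSingleton R C c) ⟨?_, hmem⟩⟩
  refine (injective_iff_map_eq_zero _).2 fun r hr => hC.2.1.1 ?_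
  rw [map_zero]
  refine LinearMap.ext fun y => ?_
  obtain ⟨t, rfl⟩ := hmem y
  have hr : r • c = 0 := hr
  simp [hr]

open IsLocalRing in
lemma IsSemidualizing.of_cinjDim_ne_top [IsNoetherianRing R] [IsLocalRing R] {C M : ModuleCat.{u} R}
    (hC : IsSemidualizing R C) (rs : List R) (hrs : ∀ r ∈ rs, r ∈ maximalIdeal R)
    (hreg : RingTheory.Sequence.IsWeaklyRegular R rs) {s : ℕ}
    (hs : maximalIdeal R ^ s ≤ Ideal.ofList rs)
    (hM : CoregTo rs M (C ⧸ (Ideal.ofList rs • ⊤ : Submodule R C))) (h : cinjDim R C M ≠ ⊤) :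
    Nonempty (R ≃ₗ[R] C) ∧ InjectiveModulo (Ideal.ofList rs) (R ⧸ Ideal.ofList rs) := by
  have := hC.1
  have hJ : Ideal.ofList rs ≤ maximalIdeal R := Ideal.span_le.2 hrs
  have hJtop : Ideal.ofList rs ≠ ⊤ := fun h =>
    (maximalIdeal.isMaximal R).ne_top (top_le_iff.1 (h ▸ hJ))
  obtain ⟨n, hn⟩ : ∃ n, HasCoresDimLE R (IsCInjective R C) n M := by
    by_contra hne
    push Not at hne
    refine h (top_le_iff.1 (le_sInf ?_))
    rintro _ ⟨n, -, hn⟩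
    exact absurd hn (hne n)
  obtain ⟨hwr, hann, hend⟩ := hC.reduction rs hreg
  obtain ⟨K, _, _, hK, hJK, ⟨φ⟩⟩ := exists_injectiveModulo_equiv_hom rs hs hJtop C hwr hann hend n
    M _ hM hn
  have hJC : ∀ r ∈ Ideal.ofList rs, ∀ y : C ⧸ (Ideal.ofList rs • ⊤ : Submodule R C), r • y = 0 := by
    intro r hr y
    obtain ⟨y, rfl⟩ := Submodule.mkQ_surjective _ y
    exact (Submodule.Quotient.mk_eq_zero _).2 (Submodule.smul_mem_smul hr trivial)
  obtain ⟨c, hc⟩ := exists_span_singleton_eq_top_of_equiv_hom hK hJC hend φ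
  refine ⟨hC.nonempty_equiv_of_span_quotient hJ ⟨c, hc⟩, ?_⟩
  have hmem (y : C ⧸ (Ideal.ofList rs • ⊤ : Submodule R C)) : ∃ r : R, r • c = y :=
    Submodule.mem_span_singleton.1 (hc ▸ trivial)
  have hker : LinearMap.ker (LinearMap.toSpanSingleton R _ c) = Ideal.ofList rs := by
    ext r
    refine ⟨fun hr => hann r fun y => ?_, fun hr => hJC r hr c⟩
    obtain ⟨t, rfl⟩ := hmem y
    rw [smul_comm, show r • c = 0 from hr, smul_zero]
  have e := (Submodule.quotEquivOfEq _ _ hker.symm).trans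
    (LinearMap.quotKerEquivOfSurjective (LinearMap.toSpanSingleton R _ c) hmem)
  let ev := LinearMap.applyₗ (R := R) (M₂ := K) c
  have hev : Function.Bijective ev := by
    constructor
    · intro f g hfg
      refine LinearMap.ext fun y => ?_
      obtain ⟨t, rfl⟩ := hmem y
      rw [map_smul, map_smul]
      exact congrArg _ hfg
    · intro z
      obtain ⟨f, hf⟩ := hK.exists_sum_eq (n := 1) (c := fun _ => c) hJK hJC hann (by simpa) z
      exact ⟨f 0, (by simpa using hf : f 0 c = z)⟩
  exact hK.of_equiv ((LinearEquiv.ofBijective ev hev).symm ≪≫ₗ φ.symm ≪≫ₗ e.symm)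

open IsLocalRing in
lemma IsSemidualizing.nonempty_equiv_of_injectiveModulo [IsNoetherianRing R] [IsLocalRing R]
    {C : ModuleCat.{u} R} (hC : IsSemidualizing R C) (rs : List R)
    (hrs : ∀ r ∈ rs, r ∈ maximalIdeal R) (hreg : RingTheory.Sequence.IsWeaklyRegular R rs)
    (hK : InjectiveModulo (Ideal.ofList rs) (R ⧸ Ideal.ofList rs)) : Nonempty (R ≃ₗ[R] C) := by
  have := hC.1
  set J := Ideal.ofList rs
  have hJ : J ≤ maximalIdeal R := Ideal.span_le.2 hrs
  obtain ⟨-, hann, hend⟩ := hC.reduction rs hreg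
  refine hC.nonempty_equiv_of_span_quotient hJ ?_
  have hJC : ∀ r ∈ J, ∀ y : C ⧸ (J • ⊤ : Submodule R C), r • y = 0 := by
    intro r hr y
    obtain ⟨y, rfl⟩ := Submodule.mkQ_surjective _ y
    exact (Submodule.Quotient.mk_eq_zero _).2 (Submodule.smul_mem_smul hr trivial)
  have hJK : ∀ r ∈ J, ∀ y : R ⧸ J, r • y = 0 := by
    intro r hr y
    obtain ⟨y, rfl⟩ := Ideal.Quotient.mk_surjective y
    exact Ideal.Quotient.eq_zero_iff_mem.2 (J.mul_mem_right y hr)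
  have unit_of {r : R} (hr : r ∉ maximalIdeal R) : ∃ t, t * r = 1 := by
    rw [mem_maximalIdeal, mem_nonunits_iff, not_not] at hr
    exact ⟨_, hr.val_inv_mul⟩
  obtain ⟨n, c, hc⟩ := Module.Finite.exists_fin (R := R) (M := C ⧸ (J • ⊤ : Submodule R C))
  obtain ⟨f, hf⟩ := hK.exists_sum_eq hJK hJC hann hc (Ideal.Quotient.mk J 1)
  choose u hu using fun i => Ideal.Quotient.mk_surjective (f i (c i))
  obtain ⟨i, hi⟩ : ∃ i, u i ∉ maximalIdeal R := by
    by_contra! h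
    simp only [← hu] at hf
    rw [← map_sum, Ideal.Quotient.eq] at hf
    have h1 := sub_mem (sum_mem fun i (_ : i ∈ Finset.univ) => h i) (hJ hf)
    rw [sub_sub_cancel] at h1
    exact (Ideal.ne_top_iff_one _).1 (maximalIdeal.isMaximal R).ne_top h1
  have hfi (r : R) : f i (r • c i) = Ideal.Quotient.mk J (r * u i) := by
    rw [map_smul, ← hu]
    rfl
  let l : (R ⧸ J) →ₗ[R] (C ⧸ (J • ⊤ : Submodule R C)) :=
    Submodule.liftQ J (LinearMap.toSpanSingleton R _ (c i)) fun r hr => hJC r hr (c i)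
  have hl (r : R) : l (Ideal.Quotient.mk J r) = r • c i := rfl
  obtain ⟨r, hr⟩ := hend (l ∘ₗ f i)
  have hrm : r ∉ maximalIdeal R := by
    intro hrm
    have h1 := hr (c i)
    rw [LinearMap.comp_apply, ← hu, hl] at h1
    have h2 := congrArg (f i) h1
    rw [hfi, hfi, Ideal.Quotient.eq, ← sub_mul] at h2
    rcases (inferInstance : (maximalIdeal R).IsPrime).mem_or_mem (hJ h2) with h3 | h3
    · exact hi (by simpa using add_mem h3 hrm)
    · exact hi h3
  obtain ⟨t, ht⟩ := unit_of hrm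
  refine ⟨c i, eq_top_iff.2 fun y _ => Submodule.mem_span_singleton.2 ?_⟩
  obtain ⟨v, hv⟩ := Ideal.Quotient.mk_surjective (f i y)
  refine ⟨t * v, ?_⟩
  have h1 := hr y
  rw [LinearMap.comp_apply, ← hv, hl] at h1
  rw [mul_smul, h1, smul_smul, ht, one_smul]

end

section
universe u
open CategoryTheory TensorProduct

section
open Pointwise
variable {R : Type u} [CommRing R]

namespace ExtMod

lemma subsingleton_of_forall_exists_smul_eq [IsLocalRing R] {E : Type*} [AddCommGroup E]
    [Module R E] [Module.Finite R E] {x : R} (hx : x ∈ IsLocalRing.maximalIdeal R)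
    (h : ∀ e : E, ∃ e', x • e' = e) : Subsingleton E := by
  rw [← Submodule.subsingleton_iff R, ← subsingleton_iff_bot_eq_top, eq_comm]
  refine Submodule.eq_bot_of_le_smul_of_le_jacobson_bot (Ideal.span {x}) _ Module.Finite.fg_top
    (fun e _ => ?_) ((Ideal.span_singleton_le_iff_mem _).2
      (IsLocalRing.maximalIdeal_le_jacobson _ hx))
  obtain ⟨e', rfl⟩ := h e
  exact Submodule.smul_mem_smul (Ideal.mem_span_singleton_self x) trivial

lemma subsingleton_of_equiv_right {N : Type u} [AddCommGroup N] [Module R N] {M M' : Type u}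
    [AddCommGroup M] [Module R M] [AddCommGroup M'] [Module R M'] (e : M ≃ₗ[R] M') {i : ℕ}
    (h : Subsingleton (ExtMod R N M i)) : Subsingleton (ExtMod R N M' i) := by
  refine Function.Surjective.subsingleton (f := post N i e.toLinearMap) fun y => ?_
  exact ⟨post N i e.symm.toLinearMap y, by
    rw [post_post, LinearEquiv.comp_symm]
    simpa using post_smul_id i (1 : R) y⟩

lemma subsingleton_of_coregTo {N : Type u} [AddCommGroup N] [Module R N] {t : ℕ} (rs : List R)
    {H K : Type u} [AddCommGroup H] [Module R H] [AddCommGroup K] [Module R K]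
    (h : CoregTo rs H K) (hH : ∀ i > t, Subsingleton (ExtMod R N H i)) :
    ∀ i > t + rs.length, Subsingleton (ExtMod R N K i) := by
  induction rs generalizing H t with
  | nil =>
    obtain ⟨e⟩ := h
    intro i hi
    exact subsingleton_of_equiv_right e (hH i hi)
  | cons x rs ih =>
    intro i hi
    refine ih (t := t + 1) h.2 (fun i hi => ?_) i (by simp at hi; omega)
    obtain ⟨i, rfl⟩ : ∃ j, i = j + 1 := ⟨i - 1, by omega⟩
    have := hH i (by omega)
    have := hH (i + 1) (by omega)
    exact subsingleton_post_left (f := (Submodule.torsionBy R H x).subtype)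
      (g := x • (LinearMap.id : H →ₗ[R] H)) (Submodule.subtype_injective _)
      (fun y => ⟨fun hy => ⟨⟨y, hy⟩, rfl⟩, fun ⟨z, hz⟩ => hz ▸ z.2⟩) h.1 i

lemma subsingleton_of_quotient [IsNoetherianRing R] [IsLocalRing R] {N : Type u} [AddCommGroup N]
    [Module R N] [Module.Finite R N] (rs : List R) (hrs : ∀ r ∈ rs, r ∈ IsLocalRing.maximalIdeal R)
    {i : ℕ} {M : Type u} [AddCommGroup M] [Module R M] [Module.Finite R M]
    (hM : RingTheory.Sequence.IsWeaklyRegular M rs)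
    (h : Subsingleton (ExtMod R N (M ⧸ (Ideal.ofList rs • ⊤ : Submodule R M)) i)) :
    Subsingleton (ExtMod R N M i) := by
  induction rs generalizing M with
  | nil => exact subsingleton_of_equiv_right (Submodule.quotEquivOfEqBot _ (by simp)) h
  | cons x rs ih =>
    have hM' := (RingTheory.Sequence.isWeaklyRegular_cons_iff _ _ _).1 hM
    have h1 : Subsingleton (ExtMod R N (QuotSMulTop x M) i) :=
      ih (fun r hr => hrs r (List.mem_cons_of_mem _ hr)) hM'.2
        (subsingleton_of_equiv_right
          (Submodule.quotOfListConsSMulTopEquivQuotSMulTopInner M x rs) h)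
    have := finite (R := R) (N := N) (M := M) i
    refine subsingleton_of_forall_exists_smul_eq (hrs x (by simp)) fun e => ?_
    obtain ⟨e', he'⟩ := (post_exact (N := N) (smul_injective hM'.1) (smul_mkQ_exact x)
      (Submodule.mkQ_surjective _) i e).1 (Subsingleton.elim _ _)
    exact ⟨e', by rw [← he', post_smul_id]⟩

lemma subsingleton_quotient_left {M : Type u} [AddCommGroup M] [Module R M] {t : ℕ} (rs : List R)
    {N : Type u} [AddCommGroup N] [Module R N] (hN : RingTheory.Sequence.IsWeaklyRegular N rs)
    (h : ∀ i > t, Subsingleton (ExtMod R N M i)) :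
    ∀ i > t + rs.length,
      Subsingleton (ExtMod R (N ⧸ (Ideal.ofList rs • ⊤ : Submodule R N)) M i) := by
  induction rs generalizing N t with
  | nil =>
    intro i hi
    have := h i hi
    exact subsingleton_of_equiv (Submodule.quotEquivOfEqBot _ (by simp)) i
  | cons x rs ih =>
    have hN' := (RingTheory.Sequence.isWeaklyRegular_cons_iff _ _ _).1 hN
    intro i hi
    have := ih (t := t + 1) hN'.2 (fun i hi => by
      obtain ⟨i, rfl⟩ : ∃ j, i = j + 1 := ⟨i - 1, by omega⟩
      have := h i (by omega)
      have := h (i + 1) (by omega)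
      exact subsingleton_pre_right (smul_injective hN'.1) (smul_mkQ_exact x)
        (Submodule.mkQ_surjective _) i) i (by simp at hi; omega)
    exact subsingleton_of_equiv (Submodule.quotOfListConsSMulTopEquivQuotSMulTopInner N x rs) i

lemma exists_extension_quotient {N N' : Type u} [AddCommGroup N] [Module R N] [AddCommGroup N']
    [Module R N'] (f : N →ₗ[R] N') (rs : List R) (hN : ∀ r ∈ rs, ∀ y : N, r • y = 0)
    (hN' : ∀ r ∈ rs, ∀ y : N', r • y = 0) {M : Type u} [AddCommGroup M] [Module R M]
    (hM : RingTheory.Sequence.IsWeaklyRegular M rs)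
    (h : Function.Surjective (pre M rs.length f)) :
    Function.Surjective (pre (M ⧸ (Ideal.ofList rs • ⊤ : Submodule R M)) 0 f) := by
  have of_equiv {M M' : Type u} [AddCommGroup M] [Module R M] [AddCommGroup M'] [Module R M']
      (e : M ≃ₗ[R] M') (h : Function.Surjective (pre M 0 f)) :
      Function.Surjective (pre M' 0 f) := fun y => by
    obtain ⟨z, hz⟩ := h (post N 0 e.symm.toLinearMap y)
    refine ⟨post N' 0 e.toLinearMap z, ?_⟩
    rw [pre_post, hz, post_post, LinearEquiv.comp_symm]
    simpa using post_smul_id 0 (1 : R) y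
  induction rs generalizing M with
  | nil => exact of_equiv (Submodule.quotEquivOfEqBot _ (by simp)).symm h
  | cons x rs ih =>
    have hM' := (RingTheory.Sequence.isWeaklyRegular_cons_iff _ _ _).1 hM
    refine of_equiv (Submodule.quotOfListConsSMulTopEquivQuotSMulTopInner M x rs).symm
      (ih (fun r hr => hN r (by simp [hr])) (fun r hr => hN' r (by simp [hr])) hM'.2 fun e => ?_)
    have hinj := smul_injective hM'.1
    have hex := smul_mkQ_exact (M := M) x
    have hsurj := Submodule.mkQ_surjective (x • (⊤ : Submodule R M))
    obtain ⟨e1, he1⟩ := h (cov N hinj hex hsurj _ e)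
    obtain ⟨e2, rfl⟩ := (cov_post_exact (N := N') hinj hex hsurj _ e1).1 (by
      rw [post_smul_id]
      exact smul_eq_zero_of_left x (hN' x (by simp)) _ e1)
    refine ⟨e2, ?_⟩
    have : Subsingleton (ExtMod R N M rs.length) :=
      subsingleton_of_isWeaklyRegular (Ideal.ofList (x :: rs)) (s := 1) (fun r hr y => by
        have hle : Ideal.ofList (x :: rs) ≤ Module.annihilator R N :=
          Ideal.span_le.2 fun r hr => Module.mem_annihilator.2 (hN r hr)
        exact Module.mem_annihilator.1 (hle (by simpa using hr)) y) (x :: rs)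
        (fun r hr => Ideal.subset_span hr) hM _ (by simp)
    have he : cov N hinj hex hsurj rs.length (pre _ rs.length f e2) =
      cov N hinj hex hsurj rs.length e := (pre_cov hinj hex hsurj rs.length f e2).symm.trans he1
    obtain ⟨a, ha⟩ := (post_cov_exact (N := N) hinj hex hsurj rs.length
      (pre _ rs.length f e2 - e)).1 (by rw [map_sub, he, sub_self])
    rw [Subsingleton.elim a 0, map_zero] at ha
    exact (sub_eq_zero.1 ha.symm)

end ExtMod
end

end

section
universe u
open CategoryTheory TensorProduct

section
variable {R : Type u} [CommRing R]

lemma HasCoresDimLE.subsingleton_ext {n : ℕ} {M : ModuleCat.{u} R}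
    (h : HasCoresDimLE R (fun N => Module.Injective R N) n M) (N : Type u) [AddCommGroup N]
    [Module R N] : ∀ i > n, Subsingleton (ExtMod R N M i) := by
  have zero {M : ModuleCat.{u} R} (h : Subsingleton M ∨ Module.Injective R M) :
      ∀ i > 0, Subsingleton (ExtMod R N M i) := by
    have hM : Module.Injective R M := h.elim (fun _ =>
      ⟨fun _ _ _ _ _ _ _ _ _ => ⟨0, fun _ => Subsingleton.elim _ _⟩⟩) id
    intro i hi
    obtain ⟨i, rfl⟩ : ∃ j, i = j + 1 := ⟨i - 1, by omega⟩
    exact ExtMod.subsingleton_of_injective hM i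
  induction n generalizing M with
  | zero => exact zero h
  | succ n ih =>
    intro i hi
    obtain ⟨i, rfl⟩ : ∃ j, i = j + 1 := ⟨i - 1, by omega⟩
    rcases h with h | ⟨X, f, hX, hf, h⟩
    · exact zero (Or.inl h) _ (by omega)
    · have := ih h i (by omega)
      have := ExtMod.subsingleton_of_injective (N := N) hX i
      exact ExtMod.subsingleton_post_left hf (LinearMap.exact_map_mkQ_range f)
        (Submodule.mkQ_surjective _) i

lemma HasCoresDimLE.of_subsingleton_ext {n : ℕ} (M : ModuleCat.{u} R)
    (h : ∀ (N : Type u) [AddCommGroup N] [Module R N] [Module.Finite R N],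
      Subsingleton (ExtMod R N M (n + 1))) :
    HasCoresDimLE R (fun N => Module.Injective R N) n M := by
  induction n generalizing M with
  | zero =>
    refine Or.inr (Module.Baer.injective fun a g => ?_)
    have := h (R ⧸ a)
    obtain ⟨e, he⟩ := ExtMod.pre_surjective (N := M) (f := Submodule.subtype a)
      (g := Submodule.mkQ a) (Submodule.subtype_injective _)
      (LinearMap.exact_subtype_mkQ a) (Submodule.mkQ_surjective _) 0 (ExtMod.homEquiv g)
    obtain ⟨g', rfl⟩ := ExtMod.homEquiv.surjective e
    rw [ExtMod.pre_homEquiv] at he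
    exact ⟨g', fun x hx => LinearMap.congr_fun (ExtMod.homEquiv.injective he) ⟨x, hx⟩⟩
  | succ n ih =>
    have : Injective (ModuleCat.of R (Injective.under M : ModuleCat.{u} R)) :=
      Injective.injective_under M
    have hinj : Module.Injective R (Injective.under M : ModuleCat.{u} R) :=
      Module.injective_module_of_injective_object R _
    have hf : Function.Injective (Injective.ι M).hom :=
      (ModuleCat.mono_iff_injective _).1 inferInstance
    refine Or.inr ⟨Injective.under M, (Injective.ι M).hom, hinj, hf, ih _ fun N _ _ _ => ?_⟩
    have := ExtMod.subsingleton_of_injective (N := N) hinj n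
    have := h N
    exact ExtMod.subsingleton_post_right hf (LinearMap.exact_map_mkQ_range _)
      (Submodule.mkQ_surjective _) (n + 1)

lemma exists_hasCoresDimLE_of_coresDim_ne_top {P : ModuleCat.{u} R → Prop} {M : ModuleCat.{u} R}
    (h : coresDim R P M ≠ ⊤) : ∃ n, HasCoresDimLE R P n M := by
  by_contra! hn
  refine h (sInf_eq_top.2 ?_)
  rintro _ ⟨n, -, h⟩
  exact absurd h (hn n)

lemma HasCoresDimLE.coresDim_ne_top {P : ModuleCat.{u} R → Prop} {M : ModuleCat.{u} R} {n : ℕ}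
    (h : HasCoresDimLE R P n M) : coresDim R P M ≠ ⊤ :=
  ne_top_of_le_ne_top (ENat.natCast_ne_top n) (sInf_le ⟨n, rfl, h⟩)

end

section
variable {R : Type u} [CommRing R] [IsNoetherianRing R] [IsLocalRing R]
open IsLocalRing

lemma subsingleton_ext_of_residue {M : Type u} [AddCommGroup M] [Module R M] [Module.Finite R M]
    {r : ℕ} (h : ∀ (N : Type u) [AddCommGroup N] [Module R N] [Module.Finite R N],
      Subsingleton (ExtMod R N M (r + 1)))
    (hk : Subsingleton (ExtMod R (R ⧸ maximalIdeal R) M r))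
    (N : Type u) [AddCommGroup N] [Module R N] [Module.Finite R N] :
    Subsingleton (ExtMod R N M r) := by
  refine IsNoetherianRing.induction_on_isQuotientEquivQuotientPrime R
    (motive := fun N _ _ _ => Subsingleton (ExtMod R N M r)) (M := N) inferInstance ?_ ?_ ?_
  · intro N _ _ _ _
    exact ExtMod.subsingleton_of_left r
  · intro N _ _ _ p e
    suffices Subsingleton (ExtMod R (R ⧸ p.1) M r) from ExtMod.subsingleton_of_equiv e r
    by_cases hp : p.1 = maximalIdeal R
    · rw [hp]
      exact hk
    obtain ⟨y, hy, hyp⟩ : ∃ y ∈ maximalIdeal R, y ∉ p.1 := by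
      by_contra! hle
      exact hp (le_antisymm (le_maximalIdeal p.2.ne_top) hle)
    have := ExtMod.finite (R := R) (N := R ⧸ p.1) (M := M) r
    refine ExtMod.subsingleton_of_forall_exists_smul_eq hy fun e => ?_
    have hinj : Function.Injective (y • (LinearMap.id : (R ⧸ p.1) →ₗ[R] (R ⧸ p.1))) := by
      rw [injective_iff_map_eq_zero]
      intro a ha
      obtain ⟨a, rfl⟩ := Ideal.Quotient.mk_surjective a
      have h1 : Ideal.Quotient.mk p.1 (y * a) = 0 := ha
      rw [Ideal.Quotient.eq_zero_iff_mem] at h1 ⊢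
      exact (p.2.mem_or_mem h1).resolve_left hyp
    have := h ((R ⧸ p.1) ⧸ LinearMap.range (y • (LinearMap.id : (R ⧸ p.1) →ₗ[R] (R ⧸ p.1))))
    obtain ⟨e', he'⟩ := ExtMod.pre_surjective (N := M) hinj (LinearMap.exact_map_mkQ_range _)
      (Submodule.mkQ_surjective _) r e
    exact ⟨e', by rw [← he', ExtMod.pre_smul_id]⟩
  · intro N₁ _ _ _ N₂ _ _ _ N₃ _ _ _ f g hf hg hex h₁ h₃
    exact ExtMod.subsingleton_pre_mid hf hex hg r

omit [IsNoetherianRing R] in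
lemma subsingleton_ext_residue {M : Type u} [AddCommGroup M] [Module R M] {r s : ℕ}
    {J : Ideal R} (hJ : J ≠ ⊤) (hs : maximalIdeal R ^ s ≤ J)
    (h : ∀ (N : Type u) [AddCommGroup N] [Module R N] [Module.Finite R N],
      Subsingleton (ExtMod R N M (r + 1)))
    (hk : Subsingleton (ExtMod R (R ⧸ J) M r)) :
    Subsingleton (ExtMod R (R ⧸ maximalIdeal R) M r) := by
  obtain ⟨t, ht, htJ⟩ := exists_not_mem_forall_mul_mem (s := s) (N := (J : Submodule R R)) hJ
    fun r hr y => by simpa [mul_comm] using J.mul_mem_left y (hs hr)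
  let f : (R ⧸ maximalIdeal R) →ₗ[R] (R ⧸ J) := (maximalIdeal R).liftQ
    (LinearMap.toSpanSingleton R (R ⧸ J) (Submodule.mkQ J t)) fun r hr => by
      rw [LinearMap.mem_ker, LinearMap.toSpanSingleton_apply, ← map_smul, Submodule.mkQ_apply,
        Submodule.Quotient.mk_eq_zero]
      exact htJ r hr
  have hf : Function.Injective f := by
    rw [← LinearMap.ker_eq_bot]
    refine Submodule.ker_liftQ_eq_bot _ _ _ fun r hr => ?_
    rw [LinearMap.mem_ker, LinearMap.toSpanSingleton_apply, ← map_smul, Submodule.mkQ_apply,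
        Submodule.Quotient.mk_eq_zero] at hr
    by_contra hrm
    rw [mem_maximalIdeal, mem_nonunits_iff, not_not] at hrm
    refine ht ?_
    simpa [← mul_assoc] using J.mul_mem_left (hrm.unit⁻¹ : Rˣ) hr
  have := h ((R ⧸ J) ⧸ LinearMap.range f)
  exact ExtMod.subsingleton_pre_left hf (LinearMap.exact_map_mkQ_range f)
    (Submodule.mkQ_surjective _) r

/-- Finite injective dimension is bounded by the length of a maximal regular sequence. -/
lemma subsingleton_ext_of_hasCoresDimLE {n s : ℕ}
    (h : HasCoresDimLE R (fun N => Module.Injective R N) n (ModuleCat.of R R)) {rs : List R}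
    (hreg : RingTheory.Sequence.IsRegular R rs) (hs : maximalIdeal R ^ s ≤ Ideal.ofList rs)
    (N : Type u) [AddCommGroup N] [Module R N] [Module.Finite R N] :
    Subsingleton (ExtMod R N R (rs.length + 1)) := by
  have hJ : Ideal.ofList rs ≠ ⊤ := fun h => hreg.top_ne_smul (by simp [h])
  have key (k : ℕ) : ∀ r, rs.length < r → n < r + k → ∀ (N : Type u) [AddCommGroup N] [Module R N]
      [Module.Finite R N], Subsingleton (ExtMod R N R r) := by
    induction k with
    | zero => exact fun r _ hr N _ _ _ => h.subsingleton_ext N r hr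
    | succ k ih =>
      intro r hr hn N _ _ _
      have h' := ih (r + 1) (by omega) (by omega)
      refine subsingleton_ext_of_residue h' (subsingleton_ext_residue hJ hs h' ?_) N
      have := ExtMod.subsingleton_quotient_left (M := R) (t := 0) rs
        hreg.toIsWeaklyRegular (fun i hi => by
          obtain ⟨i, rfl⟩ : ∃ j, i = j + 1 := ⟨i - 1, by omega⟩
          exact ExtMod.subsingleton_of_projective i) r (by omega)
      exact ExtMod.subsingleton_of_equiv (N' := R ⧸ (Ideal.ofList rs • ⊤ : Submodule R R))
        (Submodule.quotEquivOfEq _ _ (by simp)) r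
  exact key n _ (by omega) (by omega) N

lemma injectiveModulo_of_hasCoresDimLE {n s : ℕ}
    (h : HasCoresDimLE R (fun N => Module.Injective R N) n (ModuleCat.of R R)) {rs : List R}
    (hreg : RingTheory.Sequence.IsRegular R rs) (hs : maximalIdeal R ^ s ≤ Ideal.ofList rs) :
    InjectiveModulo (Ideal.ofList rs) (R ⧸ Ideal.ofList rs) := by
  refine InjectiveModulo.of_equiv (K := R ⧸ (Ideal.ofList rs • ⊤ : Submodule R R)) ?_
    (Submodule.quotEquivOfEq _ _ (by simp))
  refine InjectiveModulo.of_extension fun F Y _ _ _ _ _ hY p q hp => ?_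
  have := subsingleton_ext_of_hasCoresDimLE h hreg hs (Y ⧸ LinearMap.range p)
  have hY' : ∀ r ∈ rs, ∀ y : Y, r • y = 0 := fun r hr => hY r (Ideal.subset_span hr)
  obtain ⟨e, he⟩ := ExtMod.exists_extension_quotient p rs
    (fun r hr y => hp (by rw [map_smul, hY' r hr, map_zero])) hY' hreg.toIsWeaklyRegular
    (ExtMod.pre_surjective hp (LinearMap.exact_map_mkQ_range p) (Submodule.mkQ_surjective _)
      rs.length) (ExtMod.homEquiv q)
  obtain ⟨f, rfl⟩ := ExtMod.homEquiv.surjective e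
  rw [ExtMod.pre_homEquiv] at he
  exact ⟨f, ExtMod.homEquiv.injective he⟩

end

end

section
universe u
open CategoryTheory TensorProduct

variable {R : Type u} [CommRing R] [IsNoetherianRing R] [IsLocalRing R]
open IsLocalRing

omit [IsNoetherianRing R] in
lemma exists_pow_forall_smul_eq_zero {H A : Type u} [AddCommGroup H] [Module R H] [AddCommGroup A]
    [Module R A] [Module.Finite R A] (hann : ∀ z : H, ∃ n, ∀ r ∈ maximalIdeal R ^ n, r • z = 0)
    (f : A →ₗ[R] H) : ∃ n, ∀ r ∈ maximalIdeal R ^ n, ∀ y, r • f y = 0 := by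
  obtain ⟨k, c, hc⟩ := Module.Finite.exists_fin (R := R) (M := A)
  choose n hn using fun i => hann (f (c i))
  refine ⟨∑ i, n i, fun r hr y => ?_⟩
  have hy : y ∈ Submodule.span R (Set.range c) := hc ▸ trivial
  have hle : Submodule.span R (Set.range c) ≤ LinearMap.ker (r • f) := by
    rw [Submodule.span_le]
    rintro _ ⟨i, rfl⟩
    exact hn i r (Ideal.pow_le_pow_right (Finset.single_le_sum (fun _ _ => Nat.zero_le _)
      (Finset.mem_univ i)) hr)
  exact hle hy

/-- Artin-Rees: a map from an ideal to a torsion module kills the elements of the ideal lying in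
a high power of the maximal ideal. -/
lemma exists_pow_forall_apply_eq_zero {H : Type u} [AddCommGroup H] [Module R H]
    (hann : ∀ z : H, ∃ n, ∀ r ∈ maximalIdeal R ^ n, r • z = 0) (a : Ideal R) (f : a →ₗ[R] H) :
    ∃ n ≠ 0, ∀ y : a, (y : R) ∈ maximalIdeal R ^ n → f y = 0 := by
  obtain ⟨n, hn⟩ := exists_pow_forall_smul_eq_zero hann f
  obtain ⟨k, hk⟩ := Ideal.exists_pow_inf_eq_pow_smul (maximalIdeal R) (M := R) a
  refine ⟨n + k + 1, by omega, fun y hy => ?_⟩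
  have h1 : (y : R) ∈ (maximalIdeal R ^ (n + k + 1) • ⊤ ⊓ a : Submodule R R) :=
    ⟨by simpa using hy, y.2⟩
  rw [hk _ (by omega)] at h1
  have h2 : (y : R) ∈ maximalIdeal R ^ n • (a : Submodule R R) :=
    Submodule.smul_mono (Ideal.pow_le_pow_right (by omega)) inf_le_right h1
  have h3 : ∃ hy : (y : R) ∈ a, f ⟨y, hy⟩ = 0 := by
    refine Submodule.smul_induction_on (p := fun y => ∃ hy : y ∈ a, f ⟨y, hy⟩ = 0) h2
      (fun r hr z hz => ⟨a.mul_mem_left r hz, ?_⟩) fun x z ⟨hx, hx'⟩ ⟨hz, hz'⟩ =>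
        ⟨add_mem hx hz, ?_⟩
    · exact (map_smul f r ⟨z, hz⟩).trans (hn r hr _)
    · exact (map_add f ⟨x, hx⟩ ⟨z, hz⟩).trans (by rw [hx', hz', add_zero])
  exact h3.2

lemma injective_of_coregTo {H : Type u} [AddCommGroup H] [Module R H]
    (hann : ∀ z : H, ∃ n, ∀ r ∈ maximalIdeal R ^ n, r • z = 0)
    (h : ∀ n ≠ 0, ∃ rs : List R, (∀ r ∈ rs, r ∈ maximalIdeal R ^ n) ∧
      InjectiveModulo (Ideal.ofList rs) (R ⧸ Ideal.ofList rs) ∧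
      CoregTo rs H (R ⧸ Ideal.ofList rs)) : Module.Injective R H := by
  refine Module.Baer.injective fun a f => ?_
  obtain ⟨n, hn0, hn⟩ := exists_pow_forall_apply_eq_zero hann a f
  obtain ⟨rs, hrs, hinj, hco⟩ := h n hn0
  let j : a →ₗ[R] R ⧸ maximalIdeal R ^ n := Submodule.mkQ _ ∘ₗ Submodule.subtype a
  let i : (a ⧸ LinearMap.ker j) →ₗ[R] R ⧸ maximalIdeal R ^ n :=
    (LinearMap.ker j).liftQ j le_rfl
  have hi : Function.Injective i :=
    LinearMap.ker_eq_bot.1 (Submodule.ker_liftQ_eq_bot _ _ _ le_rfl)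
  have hY : ∀ r ∈ maximalIdeal R ^ n, ∀ y : R ⧸ maximalIdeal R ^ n, r • y = 0 := by
    intro r hr y
    obtain ⟨y, rfl⟩ := Ideal.Quotient.mk_surjective y
    exact Ideal.Quotient.eq_zero_iff_mem.2 (Ideal.mul_mem_right y _ hr)
  obtain ⟨f', hf'⟩ := hco.exists_extension (i := i)
    (fun r hr y => hi (by rw [map_smul, hY r (hrs r hr), map_zero]))
    (fun q => hinj _ _ (fun r hr => hY r (Ideal.span_le.2 hrs hr)) i q
      (by rw [LinearMap.ker_eq_bot.2 hi]; exact bot_le))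
    ((LinearMap.ker j).liftQ f fun y hy => hn y ((Submodule.Quotient.mk_eq_zero _).1 hy))
  refine ⟨f' ∘ₗ Submodule.mkQ _, fun x hx => ?_⟩
  exact LinearMap.congr_fun hf' (Submodule.mkQ _ ⟨x, hx⟩)

lemma coregTo_localCohomology_self {d : ℕ} (hdim : ringKrullDim R = (d : WithBot ℕ∞)) {rs : List R}
    (hl : rs.length = d) (hrs : ∀ r ∈ rs, r ∈ maximalIdeal R)
    (hreg : RingTheory.Sequence.IsRegular R rs) :
    CoregTo rs ((localCohomology (maximalIdeal R) d).obj (ModuleCat.of R R))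
      (R ⧸ Ideal.ofList rs) := by
  obtain ⟨s, hs⟩ := exists_pow_le_ofList hdim hl hreg
  exact (coregTo_localCohomology (ModuleCat.of R R) rs hl hrs hreg.toIsWeaklyRegular hs).trans_equiv
    (Submodule.quotEquivOfEq (Ideal.ofList rs • ⊤ : Submodule R R) _ (by simp))

lemma injective_localCohomology (hCM : IsCohenMacaulayLocalRing R) {d : ℕ}
    (hdim : ringKrullDim R = (d : WithBot ℕ∞))
    (h : ∀ rs : List R, rs.length = d → (∀ r ∈ rs, r ∈ maximalIdeal R) →
      RingTheory.Sequence.IsRegular R rs →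
      InjectiveModulo (Ideal.ofList rs) (R ⧸ Ideal.ofList rs)) :
    Module.Injective R ((localCohomology (maximalIdeal R) d).obj (ModuleCat.of R R)) := by
  refine injective_of_coregTo (fun z => ?_) fun n hn => ?_
  · obtain ⟨rs, hl, hrs, hreg⟩ := hCM.exists_isRegular hdim 1 one_ne_zero
    obtain ⟨ι, hι⟩ := exists_isExtUnion (I := maximalIdeal R) (ModuleCat.of R R) hl
      (fun r hr => Ideal.pow_le_self one_ne_zero (hrs r hr))
      hreg.toIsWeaklyRegular
    obtain ⟨n, e, rfl⟩ := hι.surj z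
    refine ⟨n, fun r hr => ?_⟩
    rw [← map_smul, ExtMod.smul_eq_zero_of_left r (fun y => ?_) d e, map_zero]
    obtain ⟨y, rfl⟩ := Ideal.Quotient.mk_surjective y
    exact Ideal.Quotient.eq_zero_iff_mem.2 (Ideal.mul_mem_right y _ hr)
  · obtain ⟨rs, hl, hrs, hreg⟩ := hCM.exists_isRegular hdim n hn
    have hrs' := fun r hr => Ideal.pow_le_self hn (hrs r hr)
    exact ⟨rs, hrs, h rs hl hrs' hreg, coregTo_localCohomology_self hdim hl hrs' hreg⟩

lemma isGorensteinLocalRing_of_injective_localCohomology (hCM : IsCohenMacaulayLocalRing R) {d : ℕ}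
    (hdim : ringKrullDim R = (d : WithBot ℕ∞))
    (h : Module.Injective R ((localCohomology (maximalIdeal R) d).obj (ModuleCat.of R R))) :
    IsGorensteinLocalRing R := by
  obtain ⟨rs, hl, hrs, hreg⟩ := hCM.exists_isRegular hdim 1 one_ne_zero
  have hrs : ∀ r ∈ rs, r ∈ maximalIdeal R := by simpa using hrs
  refine (HasCoresDimLE.of_subsingleton_ext (n := d) _ fun N _ _ _ => ?_).coresDim_ne_top
  refine ExtMod.subsingleton_of_quotient (M := R) rs hrs hreg.toIsWeaklyRegular ?_
  refine ExtMod.subsingleton_of_coregTo (t := 0) rs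
    ((coregTo_localCohomology_self hdim hl hrs hreg).trans_equiv
      (Submodule.quotEquivOfEq _ (Ideal.ofList rs • ⊤ : Submodule R R) (by simp)))
    (fun i hi => ?_) _ (by omega)
  obtain ⟨i, rfl⟩ : ∃ j, i = j + 1 := ⟨i - 1, by omega⟩
  exact ExtMod.subsingleton_of_injective h i

omit [IsNoetherianRing R] in
lemma isCInjective_localCohomology {d : ℕ} {C : ModuleCat.{u} R} (e : R ≃ₗ[R] C)
    (h : Module.Injective R ((localCohomology (maximalIdeal R) d).obj (ModuleCat.of R R))) :
    IsCInjective R C ((localCohomology (maximalIdeal R) d).obj C) :=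
  ⟨_, h, ⟨((localCohomology (maximalIdeal R) d).mapIso
    (e.toModuleIso : ModuleCat.of R R ≅ C)).symm.toLinearEquiv ≪≫ₗ
    (LinearMap.ringLmapEquivSelf R R _).symm ≪≫ₗ e.congrLeft _ R⟩⟩

end

noncomputable section
open CategoryTheory TensorProduct

/-- For a Cohen-Macaulay local ring of dimension `d` and a semidualizing
module `C`: `R` is Gorenstein iff `C-id_R H_m^d(C)` is finite, iff `H_m^d(C)` is
`C`-injective. -/
theorem stmt_12 (R : Type u) [CommRing R] [IsNoetherianRing R] [IsLocalRing R]
    (hCM : IsCohenMacaulayLocalRing R) (d : ℕ)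
    (hdim : ringKrullDim R = (d : WithBot ℕ∞))
    (C : ModuleCat.{u} R) (hC : IsSemidualizing R C) :
    (IsGorensteinLocalRing R ↔
      cinjDim R C ((localCohomology (IsLocalRing.maximalIdeal R) d).obj C) ≠ ⊤) ∧
    (IsGorensteinLocalRing R ↔
      IsCInjective R C ((localCohomology (IsLocalRing.maximalIdeal R) d).obj C)) := by
  have h12 : IsGorensteinLocalRing R →
      IsCInjective R C ((localCohomology (IsLocalRing.maximalIdeal R) d).obj C) := by
    intro hG
    obtain ⟨n, hn⟩ := exists_hasCoresDimLE_of_coresDim_ne_top hG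
    have hP (rs : List R) (hl : rs.length = d) (hreg : RingTheory.Sequence.IsRegular R rs) :
        InjectiveModulo (Ideal.ofList rs) (R ⧸ Ideal.ofList rs) := by
      obtain ⟨s, hs⟩ := exists_pow_le_ofList hdim hl hreg
      exact injectiveModulo_of_hasCoresDimLE hn hreg hs
    obtain ⟨rs, hl, hrs, hreg⟩ := hCM.exists_isRegular hdim 1 one_ne_zero
    obtain ⟨e⟩ := hC.nonempty_equiv_of_injectiveModulo rs (by simpa using hrs)
      hreg.toIsWeaklyRegular (hP rs hl hreg)
    exact isCInjective_localCohomology e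
      (injective_localCohomology hCM hdim fun rs hl _ hreg => hP rs hl hreg)
  have h23 : IsCInjective R C ((localCohomology (IsLocalRing.maximalIdeal R) d).obj C) →
      cinjDim R C ((localCohomology (IsLocalRing.maximalIdeal R) d).obj C) ≠ ⊤ := fun h =>
    HasCoresDimLE.coresDim_ne_top (n := 0) (Or.inr h)
  have h31 : cinjDim R C ((localCohomology (IsLocalRing.maximalIdeal R) d).obj C) ≠ ⊤ →
      IsGorensteinLocalRing R := by
    intro h
    refine isGorensteinLocalRing_of_injective_localCohomology hCM hdim
      (injective_localCohomology hCM hdim fun rs hl hrs hreg => ?_)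
    obtain ⟨s, hs⟩ := exists_pow_le_ofList hdim hl hreg
    have := hC.1
    exact (hC.of_cinjDim_ne_top rs hrs hreg.toIsWeaklyRegular hs
      (coregTo_localCohomology C rs hl hrs
        (hC.reduction rs hreg.toIsWeaklyRegular).1 hs) h).2
  exact ⟨⟨fun h => h23 (h12 h), h31⟩, h12, fun h => h31 (h23 h)⟩

end
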